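/- No sound and Πₙ-definable extension of Robinson arithmetic Q is Π_{n+1}-complete: if T ⊇ Q is a theory whose set of (Gödel numbers of) axioms is definable in ℕ by a Πₙ-formula and every theorem of T is true in ℕ, then there exists a Π_{n+1}-sentence true in ℕ that T does not prove. -/

import Mathlib

/-!
Formalization of results from "Gödel–Rosser's Incompleteness Theorems for
non-RE Theories" (Salehi & Seraji).

We work in the first-order language of arithmetic `{0, S, +, ×, ≤}` with the
standard model `ℕ`.  Provability `T ⊢ φ` is rendered as the semantic
consequence `T ⊨ᵇ φ` of Mathlib's model theory library, which by the Gödel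
completeness theorem coincides with provability in first-order logic.
-/

open FirstOrder Language BoundedFormula

namespace GRNonRE

/-- Function symbols of arithmetic: `0`, `S`, `+`, `×`. -/
inductive ArithFunc : ℕ → Type
  | zero : ArithFunc 0
  | succ : ArithFunc 1
  | add  : ArithFunc 2
  | mul  : ArithFunc 2

/-- The relation symbol `≤`. -/
inductive ArithRel : ℕ → Type
  | le : ArithRel 2

/-- The first-order language of arithmetic `{0, S, +, ×, ≤}`. -/
def LA : FirstOrder.Language := ⟨ArithFunc, ArithRel⟩

/-- The standard model `ℕ`. -/
instance : LA.Structure ℕ where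
  funMap {_} f := match f with
    | ArithFunc.zero => fun _ => 0
    | ArithFunc.succ => fun v => v 0 + 1
    | ArithFunc.add  => fun v => v 0 + v 1
    | ArithFunc.mul  => fun v => v 0 * v 1
  RelMap {_} r := match r with
    | ArithRel.le => fun v => v 0 ≤ v 1

def zeroT {α : Type} : LA.Term α := Term.func ArithFunc.zero ![]
def succT {α : Type} (t : LA.Term α) : LA.Term α := Term.func ArithFunc.succ ![t]
def addT {α : Type} (t s : LA.Term α) : LA.Term α := Term.func ArithFunc.add ![t, s]
def mulT {α : Type} (t s : LA.Term α) : LA.Term α := Term.func ArithFunc.mul ![t, s]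

/-- The atomic formula `t ≤ s`. -/
def leF {α : Type} {n : ℕ} (t s : LA.Term (α ⊕ Fin n)) : LA.BoundedFormula α n :=
  BoundedFormula.rel ArithRel.le ![t, s]

/-- The numeral `m̄ = S (S ⋯ (S 0))` representing `m : ℕ`. -/
def numeral : ℕ → LA.Term Empty
  | 0 => zeroT
  | n + 1 => succT (numeral n)

instance : Encodable (Σ n, LA.Functions n) :=
  ⟨fun f => match f with
    | ⟨_, ArithFunc.zero⟩ => 0
    | ⟨_, ArithFunc.succ⟩ => 1
    | ⟨_, ArithFunc.add⟩ => 2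
    | ⟨_, ArithFunc.mul⟩ => 3,
   fun n => match n with
    | 0 => some ⟨0, ArithFunc.zero⟩
    | 1 => some ⟨1, ArithFunc.succ⟩
    | 2 => some ⟨2, ArithFunc.add⟩
    | 3 => some ⟨2, ArithFunc.mul⟩
    | _ => none,
   by rintro ⟨n, f⟩; cases f <;> rfl⟩

instance : Encodable (Σ n, LA.Relations n) :=
  ⟨fun _ => 0,
   fun n => match n with
    | 0 => some ⟨2, ArithRel.le⟩
    | _ => none,
   by rintro ⟨n, r⟩; cases r; rfl⟩

/-- A standard Gödel numbering of formulas, obtained from Mathlib's structural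
encoding of bounded formulas as lists of symbols. -/
def godel {k : ℕ} (φ : LA.BoundedFormula Empty k) : ℕ :=
  Encodable.encode φ.listEncode

/-- Lift a term in context `k` to context `k + 1`. -/
def liftT {k : ℕ} (t : LA.Term (Empty ⊕ Fin k)) : LA.Term (Empty ⊕ Fin (k + 1)) :=
  t.relabel (Sum.map id Fin.castSucc)

/-- The class `Σ₀ = Π₀ = Δ₀` of bounded formulas: built from atomic formulas by
Boolean connectives (`⊥` and `⟹`, from which `∼`, `⊓`, `⊔` are definable) and
bounded universal quantification `∀ x ≤ t, φ` (bounded existential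
quantification `∃ x ≤ t, φ` is expressible as `∼ ∀ x ≤ t, ∼φ`). -/
inductive Delta0 : ∀ {k : ℕ}, LA.BoundedFormula Empty k → Prop
  | falsum {k : ℕ} : Delta0 (⊥ : LA.BoundedFormula Empty k)
  | equal {k : ℕ} (t₁ t₂ : LA.Term (Empty ⊕ Fin k)) : Delta0 (t₁ =' t₂)
  | le {k : ℕ} (t₁ t₂ : LA.Term (Empty ⊕ Fin k)) : Delta0 (leF t₁ t₂)
  | imp {k : ℕ} {φ ψ : LA.BoundedFormula Empty k} :
      Delta0 φ → Delta0 ψ → Delta0 (φ ⟹ ψ)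
  | bdall {k : ℕ} (t : LA.Term (Empty ⊕ Fin k)) {φ : LA.BoundedFormula Empty (k + 1)} :
      Delta0 φ → Delta0 ((leF (&(Fin.last k)) (liftT t) ⟹ φ).all)

mutual
  /-- The classes `Σₙ` of the arithmetical hierarchy: `Σ₀` is the class of
  bounded formulas, and `Σ_{n+1}` contains `Πₙ` and is closed under `⊓`, `⊔`,
  existential quantification and bounded universal quantification. -/
  inductive IsSigma : ℕ → ∀ {k : ℕ}, LA.BoundedFormula Empty k → Prop
    | ofDelta0 {k : ℕ} {φ : LA.BoundedFormula Empty k} : Delta0 φ → IsSigma 0 φ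
    | ofPi {n k : ℕ} {φ : LA.BoundedFormula Empty k} :
        IsPi n φ → IsSigma (n + 1) φ
    | ex {n k : ℕ} {φ : LA.BoundedFormula Empty (k + 1)} :
        IsSigma (n + 1) φ → IsSigma (n + 1) φ.ex
    | inf {n k : ℕ} {φ ψ : LA.BoundedFormula Empty k} :
        IsSigma (n + 1) φ → IsSigma (n + 1) ψ → IsSigma (n + 1) (φ ⊓ ψ)
    | sup {n k : ℕ} {φ ψ : LA.BoundedFormula Empty k} :
        IsSigma (n + 1) φ → IsSigma (n + 1) ψ → IsSigma (n + 1) (φ ⊔ ψ)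
    | bdall {n k : ℕ} (t : LA.Term (Empty ⊕ Fin k))
        {φ : LA.BoundedFormula Empty (k + 1)} :
        IsSigma (n + 1) φ → IsSigma (n + 1) ((leF (&(Fin.last k)) (liftT t) ⟹ φ).all)

  /-- The classes `Πₙ` of the arithmetical hierarchy: `Π₀` is the class of
  bounded formulas, and `Π_{n+1}` contains `Σₙ` and is closed under `⊓`, `⊔`,
  universal quantification and bounded existential quantification. -/
  inductive IsPi : ℕ → ∀ {k : ℕ}, LA.BoundedFormula Empty k → Prop
    | ofDelta0 {k : ℕ} {φ : LA.BoundedFormula Empty k} : Delta0 φ → IsPi 0 φ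
    | ofSigma {n k : ℕ} {φ : LA.BoundedFormula Empty k} :
        IsSigma n φ → IsPi (n + 1) φ
    | all {n k : ℕ} {φ : LA.BoundedFormula Empty (k + 1)} :
        IsPi (n + 1) φ → IsPi (n + 1) φ.all
    | inf {n k : ℕ} {φ ψ : LA.BoundedFormula Empty k} :
        IsPi (n + 1) φ → IsPi (n + 1) ψ → IsPi (n + 1) (φ ⊓ ψ)
    | sup {n k : ℕ} {φ ψ : LA.BoundedFormula Empty k} :
        IsPi (n + 1) φ → IsPi (n + 1) ψ → IsPi (n + 1) (φ ⊔ ψ)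
    | bdex {n k : ℕ} (t : LA.Term (Empty ⊕ Fin k))
        {φ : LA.BoundedFormula Empty (k + 1)} :
        IsPi (n + 1) φ → IsPi (n + 1) ((leF (&(Fin.last k)) (liftT t) ⊓ φ).ex)
end

/-- `T ⊢ φ`: by the Gödel completeness theorem, provability of the sentence `φ`
from the theory `T` coincides with the semantic consequence relation. -/
def Proves (T : LA.Theory) (φ : LA.Sentence) : Prop := T ⊨ᵇ φ

/-- Consistency of a theory. -/
def Consistent (T : LA.Theory) : Prop := ¬ Proves T ⊥

/-- `ψ(m̄)`: the result of substituting the numeral `m̄` for the free variable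
of a formula `ψ(x)` with one free variable. -/
def subst1 (ψ : LA.BoundedFormula Empty 1) (m : ℕ) : LA.Sentence :=
  ψ.toFormula.subst fun _ => numeral m

/-- `n`-consistency: there is no formula `ψ(x) ∈ Π_{n-1}` such that `T ⊢ ¬ψ(m̄)`
for every numeral `m̄` (`m ∈ ℕ`) and yet `T ⊢ ∃x ψ(x)`.
(`0`-consistency is ordinary consistency.) -/
def NCon : ℕ → LA.Theory → Prop
  | 0, T => Consistent T
  | n + 1, T => ¬ ∃ ψ : LA.BoundedFormula Empty 1, IsPi n ψ ∧
      (∀ m : ℕ, Proves T (∼(subst1 ψ m))) ∧ Proves T ψ.ex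

/-- The axioms of Robinson arithmetic `Q`:
`Sx ≠ 0`, `Sx = Sy → x = y`, `x ≠ 0 → ∃y x = Sy`, `x + 0 = x`,
`x + Sy = S(x + y)`, `x·0 = 0`, `x·Sy = x·y + x`, `x ≤ y ↔ ∃z z + x = y`. -/
def QTheory : LA.Theory :=
  { ∀' ∼(succT (&0) =' zeroT),
    ∀' ∀' ((succT (&0) =' succT (&1)) ⟹ (&0 =' &1)),
    ∀' (∼(&0 =' zeroT) ⟹ ∃' (&0 =' succT (&1))),
    ∀' (addT (&0) zeroT =' &0),
    ∀' ∀' (addT (&0) (succT (&1)) =' succT (addT (&0) (&1))),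
    ∀' (mulT (&0) zeroT =' zeroT),
    ∀' ∀' (mulT (&0) (succT (&1)) =' addT (mulT (&0) (&1)) (&0)),
    ((leF (&0) (&1) ⇔ ∃' (addT (&2) (&0) =' (&1)) : LA.BoundedFormula Empty 2)).alls }

/-- `T` is an extension of Robinson arithmetic `Q` (i.e. `T` proves `Q`). -/
def ExtendsQ (T : LA.Theory) : Prop := ∀ φ ∈ QTheory, Proves T φ

/-- `Πₙ-Th(ℕ)`: the set of `Πₙ`-sentences true in the standard model. -/
def PiTh (n : ℕ) : LA.Theory := {φ | IsPi n φ ∧ ℕ ⊨ φ}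

/-- Soundness: every theorem of `T` is true in `ℕ`. -/
def Sound (T : LA.Theory) : Prop := ∀ φ : LA.Sentence, Proves T φ → ℕ ⊨ φ

/-- `Σₙ`-soundness: every `Σₙ`-sentence provable in `T` is true in `ℕ`. -/
def SigmaSound (n : ℕ) (T : LA.Theory) : Prop :=
  ∀ φ : LA.Sentence, IsSigma n φ → Proves T φ → ℕ ⊨ φ

/-- A formula `Ψ(x)` with one free variable defines the set `A ⊆ ℕ` in `ℕ`. -/
def Defines (Ψ : LA.BoundedFormula Empty 1) (A : Set ℕ) : Prop :=
  ∀ m : ℕ, m ∈ A ↔ Ψ.Realize (fun e => Empty.elim e) ![m]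

/-- `A ⊆ ℕ` is definable in `ℕ` by a `Σₙ`-formula. -/
def SigmaDefinable (n : ℕ) (A : Set ℕ) : Prop := ∃ Ψ, IsSigma n Ψ ∧ Defines Ψ A

/-- `A ⊆ ℕ` is definable in `ℕ` by a `Πₙ`-formula. -/
def PiDefinable (n : ℕ) (A : Set ℕ) : Prop := ∃ Ψ, IsPi n Ψ ∧ Defines Ψ A

/-- The set of Gödel numbers of the axioms of `T`. -/
def axiomCodes (T : LA.Theory) : Set ℕ := {m | ∃ φ ∈ T, godel φ = m}

/-- The set of Gödel numbers of the theorems of `T` (its deductive closure). -/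
def theoremCodes (T : LA.Theory) : Set ℕ := {m | ∃ φ, Proves T φ ∧ godel φ = m}

section Renaming

/-- Extend a renaming of variables by one fixed last variable. -/
def extendRenaming {k m : ℕ} (τ : Fin k → Fin m) : Fin (k + 1) → Fin (m + 1) :=
  Fin.snoc (fun i => (τ i).castSucc) (Fin.last m)

theorem snoc_comp_extendRenaming {k m : ℕ} {M : Type} (τ : Fin k → Fin m) (v : Fin m → M) (a : M) :
    (Fin.snoc v a : Fin (m + 1) → M) ∘ extendRenaming τ = Fin.snoc (v ∘ τ) a := by
  funext i
  refine Fin.lastCases ?_ (fun i => ?_) i <;> simp [extendRenaming]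

theorem realize_leF {k : ℕ} {v : Empty → ℕ} {xs : Fin k → ℕ} (t s : LA.Term (Empty ⊕ Fin k)) :
    (leF t s).Realize v xs ↔ t.realize (Sum.elim v xs) ≤ s.realize (Sum.elim v xs) :=
  Iff.rfl

theorem realize_liftT {k : ℕ} {v : Empty → ℕ} {xs : Fin k → ℕ} (a : ℕ)
    (t : LA.Term (Empty ⊕ Fin k)) :
    (liftT t).realize (Sum.elim v (Fin.snoc xs a : Fin (k + 1) → ℕ)) =
      t.realize (Sum.elim v xs) := by
  rw [liftT, Term.realize_relabel]
  congr 1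
  funext i
  rcases i with i | i <;> simp

theorem realize_bdall {k : ℕ} {v : Empty → ℕ} {xs : Fin k → ℕ} (t : LA.Term (Empty ⊕ Fin k))
    (φ : LA.BoundedFormula Empty (k + 1)) :
    ((leF (&(Fin.last k)) (liftT t) ⟹ φ).all).Realize v xs ↔
      ∀ a ≤ t.realize (Sum.elim v xs), φ.Realize v (Fin.snoc xs a) := by
  simp only [realize_all, realize_imp, realize_leF, realize_liftT]
  simp

theorem realize_bdex {k : ℕ} {v : Empty → ℕ} {xs : Fin k → ℕ} (t : LA.Term (Empty ⊕ Fin k))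
    (φ : LA.BoundedFormula Empty (k + 1)) :
    ((leF (&(Fin.last k)) (liftT t) ⊓ φ).ex).Realize v xs ↔
      ∃ a ≤ t.realize (Sum.elim v xs), φ.Realize v (Fin.snoc xs a) := by
  simp only [realize_ex, realize_inf, realize_leF, realize_liftT]
  simp

/-- `φ'` expresses `φ` after renaming its variables along `τ`. -/
def IsRenaming {k m : ℕ} (τ : Fin k → Fin m) (φ : LA.BoundedFormula Empty k)
    (φ' : LA.BoundedFormula Empty m) : Prop :=
  ∀ (v : Empty → ℕ) (xs : Fin m → ℕ), φ'.Realize v xs ↔ φ.Realize v (xs ∘ τ)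

theorem realize_relabel_map {k m : ℕ} (τ : Fin k → Fin m) (t : LA.Term (Empty ⊕ Fin k))
    (v : Empty → ℕ) (xs : Fin m → ℕ) :
    (t.relabel (Sum.map id τ)).realize (Sum.elim v xs) = t.realize (Sum.elim v (xs ∘ τ)) := by
  rw [Term.realize_relabel]
  congr 1
  funext i
  rcases i with i | i <;> simp

theorem Delta0.exists_renaming {k : ℕ} {φ : LA.BoundedFormula Empty k} (h : Delta0 φ) :
    ∀ {m : ℕ} (τ : Fin k → Fin m), ∃ φ', Delta0 φ' ∧ IsRenaming τ φ φ' := by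
  induction h with
  | falsum => exact fun τ => ⟨_, .falsum, fun v xs => by simp⟩
  | equal t s =>
    exact fun τ => ⟨_, .equal (t.relabel (Sum.map id τ)) (s.relabel (Sum.map id τ)),
      fun v xs => by simp only [realize_bdEqual, realize_relabel_map]⟩
  | le t s =>
    exact fun τ => ⟨_, .le (t.relabel (Sum.map id τ)) (s.relabel (Sum.map id τ)),
      fun v xs => by simp only [realize_leF, realize_relabel_map]⟩
  | imp _ _ ih₁ ih₂ =>
    intro m τ
    obtain ⟨φ', h₁, r₁⟩ := ih₁ τ
    obtain ⟨ψ', h₂, r₂⟩ := ih₂ τ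
    exact ⟨_, .imp h₁ h₂, fun v xs => by rw [realize_imp, realize_imp, r₁, r₂]⟩
  | bdall t _ ih =>
    intro m τ
    obtain ⟨φ', h, r⟩ := ih (extendRenaming τ)
    refine ⟨_, .bdall (t.relabel (Sum.map id τ)) h, fun v xs => ?_⟩
    simp only [realize_bdall, realize_relabel_map, r _ _, snoc_comp_extendRenaming]

mutual

theorem IsSigma.exists_renaming : ∀ {n k : ℕ} {φ : LA.BoundedFormula Empty k}, IsSigma n φ →
    ∀ {m : ℕ} (τ : Fin k → Fin m), ∃ φ', IsSigma n φ' ∧ IsRenaming τ φ φ'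
  | _, _, _, .ofDelta0 h, _, τ =>
    let ⟨φ', h', r⟩ := h.exists_renaming τ
    ⟨φ', .ofDelta0 h', r⟩
  | _, _, _, .ofPi h, _, τ =>
    let ⟨φ', h', r⟩ := h.exists_renaming τ
    ⟨φ', .ofPi h', r⟩
  | _, _, _, .ex h, _, τ =>
    let ⟨φ', h', r⟩ := h.exists_renaming (extendRenaming τ)
    ⟨_, .ex h', fun v xs => by
      simp only [realize_ex, r _ _, snoc_comp_extendRenaming]⟩
  | _, _, _, .inf h₁ h₂, _, τ =>
    let ⟨_, h₁', r₁⟩ := h₁.exists_renaming τ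
    let ⟨_, h₂', r₂⟩ := h₂.exists_renaming τ
    ⟨_, .inf h₁' h₂', fun v xs => by rw [realize_inf, realize_inf, r₁, r₂]⟩
  | _, _, _, .sup h₁ h₂, _, τ =>
    let ⟨_, h₁', r₁⟩ := h₁.exists_renaming τ
    let ⟨_, h₂', r₂⟩ := h₂.exists_renaming τ
    ⟨_, .sup h₁' h₂', fun v xs => by rw [realize_sup, realize_sup, r₁, r₂]⟩
  | _, _, _, .bdall t h, _, τ =>
    let ⟨_, h', r⟩ := h.exists_renaming (extendRenaming τ)
    ⟨_, .bdall (t.relabel (Sum.map id τ)) h', fun v xs => by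
      simp only [realize_bdall, realize_relabel_map, r _ _, snoc_comp_extendRenaming]⟩

theorem IsPi.exists_renaming : ∀ {n k : ℕ} {φ : LA.BoundedFormula Empty k}, IsPi n φ →
    ∀ {m : ℕ} (τ : Fin k → Fin m), ∃ φ', IsPi n φ' ∧ IsRenaming τ φ φ'
  | _, _, _, .ofDelta0 h, _, τ =>
    let ⟨φ', h', r⟩ := h.exists_renaming τ
    ⟨φ', .ofDelta0 h', r⟩
  | _, _, _, .ofSigma h, _, τ =>
    let ⟨φ', h', r⟩ := h.exists_renaming τ
    ⟨φ', .ofSigma h', r⟩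
  | _, _, _, .all h, _, τ =>
    let ⟨φ', h', r⟩ := h.exists_renaming (extendRenaming τ)
    ⟨_, .all h', fun v xs => by
      simp only [realize_all, r _ _, snoc_comp_extendRenaming]⟩
  | _, _, _, .inf h₁ h₂, _, τ =>
    let ⟨_, h₁', r₁⟩ := h₁.exists_renaming τ
    let ⟨_, h₂', r₂⟩ := h₂.exists_renaming τ
    ⟨_, .inf h₁' h₂', fun v xs => by rw [realize_inf, realize_inf, r₁, r₂]⟩
  | _, _, _, .sup h₁ h₂, _, τ =>
    let ⟨_, h₁', r₁⟩ := h₁.exists_renaming τ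
    let ⟨_, h₂', r₂⟩ := h₂.exists_renaming τ
    ⟨_, .sup h₁' h₂', fun v xs => by rw [realize_sup, realize_sup, r₁, r₂]⟩
  | _, _, _, .bdex t h, _, τ =>
    let ⟨_, h', r⟩ := h.exists_renaming (extendRenaming τ)
    ⟨_, .bdex (t.relabel (Sum.map id τ)) h', fun v xs => by
      simp only [realize_bdex, realize_relabel_map, r _ _, snoc_comp_extendRenaming]⟩

end

end Renaming

section Negation

/-- `φ'` expresses the negation of `φ` in `ℕ`. -/
def IsNegation {k : ℕ} (φ φ' : LA.BoundedFormula Empty k) : Prop :=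
  ∀ (v : Empty → ℕ) (xs : Fin k → ℕ), φ'.Realize v xs ↔ ¬ φ.Realize v xs

theorem Delta0.isNegation_not {k : ℕ} {φ : LA.BoundedFormula Empty k} (h : Delta0 φ) :
    Delta0 (∼φ) ∧ IsNegation φ (∼φ) :=
  ⟨.imp h .falsum, fun _ _ => realize_not⟩

mutual

theorem IsSigma.exists_negation : ∀ {n k : ℕ} {φ : LA.BoundedFormula Empty k}, IsSigma n φ →
    ∃ φ', IsPi n φ' ∧ IsNegation φ φ'
  | _, _, _, .ofDelta0 h => ⟨_, .ofDelta0 h.isNegation_not.1, h.isNegation_not.2⟩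
  | _, _, _, .ofPi h =>
    let ⟨φ', h', r⟩ := h.exists_negation
    ⟨φ', .ofSigma h', r⟩
  | _, _, _, .ex h =>
    let ⟨φ', h', r⟩ := h.exists_negation
    ⟨_, .all h', fun v xs => by simp only [realize_ex, realize_all, r _ _, not_exists]⟩
  | _, _, _, .inf h₁ h₂ =>
    let ⟨_, h₁', r₁⟩ := h₁.exists_negation
    let ⟨_, h₂', r₂⟩ := h₂.exists_negation
    ⟨_, .sup h₁' h₂', fun v xs => by
      rw [realize_inf, realize_sup, r₁, r₂, not_and_or]⟩
  | _, _, _, .sup h₁ h₂ =>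
    let ⟨_, h₁', r₁⟩ := h₁.exists_negation
    let ⟨_, h₂', r₂⟩ := h₂.exists_negation
    ⟨_, .inf h₁' h₂', fun v xs => by
      rw [realize_inf, realize_sup, r₁, r₂, not_or]⟩
  | _, _, _, .bdall t h =>
    let ⟨_, h', r⟩ := h.exists_negation
    ⟨_, .bdex t h', fun v xs => by simp only [realize_bdall, realize_bdex, r _ _]; simp⟩

theorem IsPi.exists_negation : ∀ {n k : ℕ} {φ : LA.BoundedFormula Empty k}, IsPi n φ →
    ∃ φ', IsSigma n φ' ∧ IsNegation φ φ'
  | _, _, _, .ofDelta0 h => ⟨_, .ofDelta0 h.isNegation_not.1, h.isNegation_not.2⟩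
  | _, _, _, .ofSigma h =>
    let ⟨φ', h', r⟩ := h.exists_negation
    ⟨φ', .ofPi h', r⟩
  | _, _, _, .all h =>
    let ⟨φ', h', r⟩ := h.exists_negation
    ⟨_, .ex h', fun v xs => by simp only [realize_ex, realize_all, r _ _, not_forall]⟩
  | _, _, _, .inf h₁ h₂ =>
    let ⟨_, h₁', r₁⟩ := h₁.exists_negation
    let ⟨_, h₂', r₂⟩ := h₂.exists_negation
    ⟨_, .sup h₁' h₂', fun v xs => by
      rw [realize_inf, realize_sup, r₁, r₂, not_and_or]⟩
  | _, _, _, .sup h₁ h₂ =>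
    let ⟨_, h₁', r₁⟩ := h₁.exists_negation
    let ⟨_, h₂', r₂⟩ := h₂.exists_negation
    ⟨_, .inf h₁' h₂', fun v xs => by
      rw [realize_inf, realize_sup, r₁, r₂, not_or]⟩
  | _, _, _, .bdex t h =>
    let ⟨_, h', r⟩ := h.exists_negation
    ⟨_, .bdall t h', fun v xs => by simp only [realize_bdall, realize_bdex, r _ _]; simp⟩

end

theorem Delta0.isPi {k : ℕ} {φ : LA.BoundedFormula Empty k} (h : Delta0 φ) :
    ∀ n, IsPi n φ
  | 0 => .ofDelta0 h
  | n + 1 => by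
    have key : ∀ n, IsSigma n φ ∧ IsPi n φ := fun n => by
      induction n with
      | zero => exact ⟨.ofDelta0 h, .ofDelta0 h⟩
      | succ n ih => exact ⟨.ofPi ih.2, .ofSigma ih.1⟩
    exact (key _).2

end Negation

section SigmaRelations

variable {n k : ℕ}

/-- The relation `R` on `ℕ` is definable by a `Σ_{n+1}`-formula. -/
def SigmaRel (n : ℕ) {k : ℕ} (R : (Fin k → ℕ) → Prop) : Prop :=
  ∃ ψ : LA.BoundedFormula Empty k, IsSigma (n + 1) ψ ∧ ∀ xs, ψ.Realize default xs ↔ R xs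

/-- The graph of `f` is definable by a `Σ_{n+1}`-formula. -/
structure SigmaFun (n : ℕ) {k : ℕ} (f : (Fin k → ℕ) → ℕ) : Prop where
  graph : SigmaRel n fun w : Fin (k + 1) → ℕ => w (Fin.last k) = f (Fin.init w)

namespace SigmaRel

theorem congr {R R' : (Fin k → ℕ) → Prop} (h : SigmaRel n R') (e : ∀ v, R v ↔ R' v) :
    SigmaRel n R :=
  let ⟨ψ, hψ, r⟩ := h
  ⟨ψ, hψ, fun v => (r v).trans (e v).symm⟩

theorem rename {m : ℕ} {R : (Fin m → ℕ) → Prop} (h : SigmaRel n R) (τ : Fin m → Fin k) :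
    SigmaRel n fun v => R (v ∘ τ) :=
  let ⟨_, hψ, r⟩ := h
  let ⟨ψ', hψ', r'⟩ := hψ.exists_renaming τ
  ⟨ψ', hψ', fun v => (r' _ v).trans (r _)⟩

theorem and {R R' : (Fin k → ℕ) → Prop} (h : SigmaRel n R) (h' : SigmaRel n R') :
    SigmaRel n fun v => R v ∧ R' v :=
  let ⟨_, hψ, r⟩ := h
  let ⟨_, hψ', r'⟩ := h'
  ⟨_, .inf hψ hψ', fun v => by rw [realize_inf, r, r']⟩

theorem or {R R' : (Fin k → ℕ) → Prop} (h : SigmaRel n R) (h' : SigmaRel n R') :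
    SigmaRel n fun v => R v ∨ R' v :=
  let ⟨_, hψ, r⟩ := h
  let ⟨_, hψ', r'⟩ := h'
  ⟨_, .sup hψ hψ', fun v => by rw [realize_sup, r, r']⟩

theorem ex {R : (Fin k → ℕ) → ℕ → Prop}
    (h : SigmaRel n fun w : Fin (k + 1) → ℕ => R (Fin.init w) (w (Fin.last k))) :
    SigmaRel n fun v => ∃ x, R v x :=
  let ⟨_, hψ, r⟩ := h
  ⟨_, .ex hψ, fun v => by simp only [realize_ex, r, Fin.init_snoc, Fin.snoc_last]⟩

theorem of_delta0 {R : (Fin k → ℕ) → Prop} (ψ : LA.BoundedFormula Empty k) (h : Delta0 ψ)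
    (r : ∀ xs, ψ.Realize default xs ↔ R xs) : SigmaRel n R :=
  ⟨ψ, .ofPi (h.isPi n), r⟩

theorem comp₁ {P : ℕ → Prop} (hP : SigmaRel n fun v : Fin 1 → ℕ => P (v 0))
    {f : (Fin k → ℕ) → ℕ} (hf : SigmaFun n f) : SigmaRel n fun v => P (f v) :=
  (ex (R := fun v x => x = f v ∧ P x) (hf.graph.and (hP.rename fun _ => Fin.last k))).congr
    fun v => by simp

theorem _root_.GRNonRE.SigmaFun.weaken {f : (Fin k → ℕ) → ℕ} (hf : SigmaFun n f) :
    SigmaFun n fun w : Fin (k + 1) → ℕ => f (Fin.init w) := by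
  refine ⟨(hf.graph.rename (extendRenaming Fin.castSucc)).congr fun v => ?_⟩
  have h : Fin.init (v ∘ extendRenaming Fin.castSucc) = Fin.init (Fin.init v) := by
    funext i
    simp [extendRenaming, Fin.init]
  rw [h]
  simp [extendRenaming]

theorem comp₂ {P : ℕ → ℕ → Prop} (hP : SigmaRel n fun v : Fin 2 → ℕ => P (v 0) (v 1))
    {f g : (Fin k → ℕ) → ℕ} (hf : SigmaFun n f) (hg : SigmaFun n g) :
    SigmaRel n fun v => P (f v) (g v) := by
  have h : SigmaRel n fun w : Fin (k + 1) → ℕ => P (w (Fin.last k)) (g (Fin.init w)) :=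
    (ex (R := fun w x => x = g (Fin.init w) ∧ P (w (Fin.last k)) x)
      (hg.weaken.graph.and (hP.rename ![(Fin.last k).castSucc, Fin.last (k + 1)]))).congr
      fun v => by simp
  exact (ex (R := fun v x => x = f v ∧ P x (g v)) (hf.graph.and h)).congr fun v => by simp

theorem comp₃ {P : ℕ → ℕ → ℕ → Prop}
    (hP : SigmaRel n fun v : Fin 3 → ℕ => P (v 0) (v 1) (v 2))
    {f g h : (Fin k → ℕ) → ℕ} (hf : SigmaFun n f) (hg : SigmaFun n g) (hh : SigmaFun n h) :
    SigmaRel n fun v => P (f v) (g v) (h v) := by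
  have h₁ : SigmaRel n fun w : Fin (k + 2) → ℕ =>
      P (w (Fin.last k).castSucc) (w (Fin.last (k + 1))) (h (Fin.init (Fin.init w))) :=
    (ex (R := fun w x => x = h (Fin.init (Fin.init w)) ∧
        P (w (Fin.last k).castSucc) (w (Fin.last (k + 1))) x)
      (hh.weaken.weaken.graph.and (hP.rename
        ![(Fin.last k).castSucc.castSucc, (Fin.last (k + 1)).castSucc, Fin.last (k + 2)]))).congr
      fun v => by simp
  have h₂ : SigmaRel n fun w : Fin (k + 1) → ℕ =>
      P (w (Fin.last k)) (g (Fin.init w)) (h (Fin.init w)) :=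
    (ex (R := fun w x => x = g (Fin.init w) ∧ P (w (Fin.last k)) x (h (Fin.init w)))
      (hg.weaken.graph.and h₁)).congr fun v => by simp
  exact (ex (R := fun v x => x = f v ∧ P x (g v) (h v)) (hf.graph.and h₂)).congr fun v => by simp

theorem eq {f g : (Fin k → ℕ) → ℕ} (hf : SigmaFun n f) (hg : SigmaFun n g) :
    SigmaRel n fun v => f v = g v :=
  comp₂ (P := fun x y => x = y)
    (of_delta0 _ (.equal (&0) (&1)) fun v => by simp) hf hg

theorem le {f g : (Fin k → ℕ) → ℕ} (hf : SigmaFun n f) (hg : SigmaFun n g) :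
    SigmaRel n fun v => f v ≤ g v :=
  comp₂ (P := fun x y => x ≤ y)
    (of_delta0 _ (.le (&0) (&1)) fun v => by simp [realize_leF]) hf hg

theorem ball {R : (Fin k → ℕ) → ℕ → Prop} {f : (Fin k → ℕ) → ℕ} (hf : SigmaFun n f)
    (h : SigmaRel n fun w : Fin (k + 1) → ℕ => R (Fin.init w) (w (Fin.last k))) :
    SigmaRel n fun v => ∀ x ≤ f v, R v x := by
  obtain ⟨ψ, hψ, r⟩ := h.rename (extendRenaming (Fin.castSucc (n := k)))
  have h' : SigmaRel n fun w : Fin (k + 1) → ℕ =>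
      ∀ x ≤ w (Fin.last k), R (Fin.init w) x := by
    refine ⟨_, .bdall (&(Fin.last k)) hψ, fun v => ?_⟩
    rw [realize_bdall]
    refine forall₂_congr fun x _ => (r _).trans ?_
    have e : (Fin.snoc v x : Fin (k + 2) → ℕ) ∘ extendRenaming Fin.castSucc
        = Fin.snoc (Fin.init v) x := by
      rw [snoc_comp_extendRenaming]
      rfl
    simp only [e, Fin.init_snoc, Fin.snoc_last]
  exact (ex (R := fun v y => y = f v ∧ ∀ x ≤ y, R v x) (hf.graph.and h')).congr fun v => by simp

end SigmaRel

namespace SigmaFun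

theorem var (i : Fin k) : SigmaFun n fun v : Fin k → ℕ => v i :=
  ⟨.of_delta0 _ (.equal (&(Fin.last k)) (&i.castSucc)) fun v => by simp [Fin.init]⟩

theorem succ {f : (Fin k → ℕ) → ℕ} (hf : SigmaFun n f) : SigmaFun n fun v => f v + 1 :=
  ⟨SigmaRel.comp₂ (P := fun x y => x = y + 1)
    (.of_delta0 _ (.equal (&0) (succT (&1))) fun v => by
      rw [realize_bdEqual]
      rfl)
    (var (Fin.last k)) hf.weaken⟩

theorem const (c : ℕ) : SigmaFun n fun _ : Fin k → ℕ => c := by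
  induction c with
  | zero =>
    refine ⟨.of_delta0 _ (.equal (&(Fin.last k)) zeroT) fun v => ?_⟩
    rw [realize_bdEqual]
    rfl
  | succ c ih => exact ih.succ

theorem add {f g : (Fin k → ℕ) → ℕ} (hf : SigmaFun n f) (hg : SigmaFun n g) :
    SigmaFun n fun v => f v + g v :=
  ⟨SigmaRel.comp₃ (P := fun x y z => x = y + z)
    (.of_delta0 _ (.equal (&0) (addT (&1) (&2))) fun v => by
      rw [realize_bdEqual]
      rfl)
    (var (Fin.last k)) hf.weaken hg.weaken⟩

theorem mul {f g : (Fin k → ℕ) → ℕ} (hf : SigmaFun n f) (hg : SigmaFun n g) :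
    SigmaFun n fun v => f v * g v :=
  ⟨SigmaRel.comp₃ (P := fun x y z => x = y * z)
    (.of_delta0 _ (.equal (&0) (mulT (&1) (&2))) fun v => by
      rw [realize_bdEqual]
      rfl)
    (var (Fin.last k)) hf.weaken hg.weaken⟩

end SigmaFun

namespace SigmaRel

theorem lt {f g : (Fin k → ℕ) → ℕ} (hf : SigmaFun n f) (hg : SigmaFun n g) :
    SigmaRel n fun v => f v < g v :=
  le hf.succ hg

end SigmaRel

namespace SigmaFun

theorem pair {f g : (Fin k → ℕ) → ℕ} (hf : SigmaFun n f) (hg : SigmaFun n g) :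
    SigmaFun n fun v => Nat.pair (f v) (g v) := by
  have h : SigmaRel n fun w : Fin (k + 1) → ℕ =>
      (f (Fin.init w) < g (Fin.init w) ∧
        w (Fin.last k) = g (Fin.init w) * g (Fin.init w) + f (Fin.init w)) ∨
      (g (Fin.init w) ≤ f (Fin.init w) ∧
        w (Fin.last k) = f (Fin.init w) * f (Fin.init w) + f (Fin.init w) + g (Fin.init w)) :=
    ((SigmaRel.lt hf.weaken hg.weaken).and
      (.eq (var _) ((hg.weaken.mul hg.weaken).add hf.weaken))).or
    ((SigmaRel.le hg.weaken hf.weaken).and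
      (.eq (var _) (((hf.weaken.mul hf.weaken).add hf.weaken).add hg.weaken)))
  refine ⟨h.congr fun w => ?_⟩
  simp only [Nat.pair]
  split_ifs <;> grind

theorem beta {f g : (Fin k → ℕ) → ℕ} (hf : SigmaFun n f) (hg : SigmaFun n g) :
    SigmaFun n fun v => Nat.beta (f v) (g v) := by
  have h : SigmaRel n fun v : Fin 3 → ℕ => ∃ a b q, v 1 = Nat.pair a b ∧
      a = ((v 2 + 1) * b + 1) * q + v 0 ∧ v 0 < (v 2 + 1) * b + 1 := by
    repeat' first
      | apply SigmaFun.var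
      | apply SigmaRel.ex
      | apply SigmaRel.and
      | apply SigmaRel.eq
      | apply SigmaRel.lt
      | apply SigmaFun.pair
      | apply SigmaFun.mul
      | apply SigmaFun.succ
      | apply SigmaFun.add
  refine ⟨(SigmaRel.comp₃ (P := fun x y z => ∃ a b q, y = Nat.pair a b ∧
    a = ((z + 1) * b + 1) * q + x ∧ x < (z + 1) * b + 1) h
    (var (Fin.last k)) hf.weaken hg.weaken).congr fun w => ?_⟩
  constructor
  · intro e
    refine ⟨_, _, (f (Fin.init w)).unpair.1 /
      ((g (Fin.init w) + 1) * (f (Fin.init w)).unpair.2 + 1), (Nat.pair_unpair _).symm, ?_, ?_⟩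
    · rw [e]
      exact (Nat.div_add_mod _ _).symm
    · rw [e]
      exact Nat.mod_lt _ (Nat.succ_pos _)
  · rintro ⟨a, b, q, e, rfl, hlt⟩
    simp only [e, Nat.beta]
    rw [Nat.unpair_pair, Nat.mul_add_mod, Nat.mod_eq_of_lt hlt]

end SigmaFun

/-- The predicate generated by the axioms `B` and the two-premise rules `S`. -/
inductive Derivable (B : ℕ → Prop) (S : ℕ → ℕ → ℕ → Prop) : ℕ → Prop
  | base {x : ℕ} : B x → Derivable B S x
  | step {y z x : ℕ} : Derivable B S y → Derivable B S z → S y z x → Derivable B S x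

/-- Every entry of the list follows from `B`, or by `S` from later entries. -/
def IsDerivation (B : ℕ → Prop) (S : ℕ → ℕ → ℕ → Prop) : List ℕ → Prop
  | [] => True
  | x :: l => (B x ∨ ∃ y ∈ l, ∃ z ∈ l, S y z x) ∧ IsDerivation B S l

variable {B : ℕ → Prop} {S : ℕ → ℕ → ℕ → Prop}

theorem IsDerivation.append {l l' : List ℕ} (h : IsDerivation B S l)
    (h' : IsDerivation B S l') : IsDerivation B S (l ++ l') := by
  induction l with
  | nil => exact h'
  | cons x l ih =>
    refine ⟨h.1.imp_right ?_, ih h.2⟩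
    rintro ⟨y, hy, z, hz, s⟩
    exact ⟨y, List.mem_append_left _ hy, z, List.mem_append_left _ hz, s⟩

theorem Derivable.exists_isDerivation {x : ℕ} (h : Derivable B S x) :
    ∃ l, IsDerivation B S (x :: l) := by
  induction h with
  | base h => exact ⟨[], .inl h, trivial⟩
  | @step y z x _ _ s ihy ihz =>
    obtain ⟨l, hl⟩ := ihy
    obtain ⟨l', hl'⟩ := ihz
    exact ⟨(y :: l) ++ (z :: l'), .inr ⟨y, by simp, z, by simp, s⟩, hl.append hl'⟩

theorem IsDerivation.getElem {l : List ℕ} (h : IsDerivation B S l) (i : ℕ) (hi : i < l.length) :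
    B l[i] ∨ ∃ j k, ∃ (hj : j < l.length) (hk : k < l.length), i < j ∧ i < k ∧ S l[j] l[k] l[i] := by
  induction l generalizing i with
  | nil => simp at hi
  | cons x l ih =>
    cases i with
    | zero =>
      refine h.1.imp_right ?_
      rintro ⟨y, hy, z, hz, s⟩
      obtain ⟨j, hj, rfl⟩ := List.getElem_of_mem hy
      obtain ⟨k, hk, rfl⟩ := List.getElem_of_mem hz
      exact ⟨j + 1, k + 1, by simpa, by simpa, by simp, by simp, by simpa⟩
    | succ i =>
      refine (ih h.2 i (by simpa using hi)).imp id ?_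
      rintro ⟨j, k, hj, hk, h₁, h₂, s⟩
      exact ⟨j + 1, k + 1, by simpa, by simpa, by simpa, by simpa, by simpa⟩

theorem derivable_iff_beta {x : ℕ} : Derivable B S x ↔ ∃ c L, Nat.beta c 0 = x ∧
    ∀ i ≤ L, B (Nat.beta c i) ∨ ∃ j k, i < j ∧ j ≤ L ∧ i < k ∧ k ≤ L ∧
      S (Nat.beta c j) (Nat.beta c k) (Nat.beta c i) := by
  constructor
  · intro h
    obtain ⟨l, hl⟩ := h.exists_isDerivation
    have hb (i : ℕ) (hi : i < (x :: l).length) :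
        Nat.beta (Nat.unbeta (x :: l)) i = (x :: l)[i] := Nat.beta_unbeta_coe (x :: l) ⟨i, hi⟩
    refine ⟨Nat.unbeta (x :: l), l.length, hb 0 (by simp), fun i hi => ?_⟩
    have hi' : i < (x :: l).length := by simpa [Nat.lt_succ_iff] using hi
    rw [hb i hi']
    refine (hl.getElem i hi').imp_right ?_
    rintro ⟨j, k, hj, hk, h₁, h₂, s⟩
    rw [← hb j hj, ← hb k hk] at s
    exact ⟨j, k, h₁, by simpa [Nat.lt_succ_iff] using hj, h₂,
      by simpa [Nat.lt_succ_iff] using hk, s⟩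
  · rintro ⟨c, L, rfl, h⟩
    suffices ∀ d i, L - i = d → i ≤ L → Derivable B S (Nat.beta c i) from
      this _ 0 rfl (Nat.zero_le _)
    intro d
    induction d using Nat.strong_induction_on with
    | _ d ih =>
      intro i hd hi
      rcases h i hi with hB | ⟨j, k, hj, hjL, hk, hkL, s⟩
      · exact .base hB
      · exact .step (ih (L - j) (by omega) j rfl hjL) (ih (L - k) (by omega) k rfl hkL) s

theorem SigmaRel.derivable (hB : SigmaRel n fun v : Fin 1 → ℕ => B (v 0))
    (hS : SigmaRel n fun v : Fin 3 → ℕ => S (v 0) (v 1) (v 2))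
    {f : (Fin k → ℕ) → ℕ} (hf : SigmaFun n f) :
    SigmaRel n fun v => Derivable B S (f v) := by
  refine SigmaRel.comp₁ (SigmaRel.congr ?_ fun v => derivable_iff_beta) hf
  repeat' first
    | apply SigmaFun.var
    | apply SigmaRel.comp₁ hB
    | apply SigmaRel.comp₃ hS
    | apply SigmaRel.ex
    | apply SigmaRel.and
    | apply SigmaRel.or
    | apply SigmaRel.ball
    | apply SigmaRel.eq
    | apply SigmaRel.lt
    | apply SigmaRel.le
    | apply SigmaFun.beta
    | apply SigmaFun.const

end SigmaRelations

section Codes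

open Encodable

/-- The code of a nonempty list with given head and code of the tail. -/
def consCode (x l : ℕ) : ℕ := Nat.pair x l + 1

theorem encode_eq_encode_map {α : Type} [Encodable α] (l : List α) :
    encode l = encode (l.map encode) := by
  induction l with
  | nil => rfl
  | cons a l ih => simp only [List.map_cons, encode_list_cons, ih, encode_nat]

theorem encode_cons (x : ℕ) (l : List ℕ) : encode (x :: l) = consCode x (encode l) := by
  simp [consCode]

/-- The code of the concatenation of two coded lists. -/
def appendCode (a b : ℕ) : ℕ :=
  encode (Denumerable.ofNat (List ℕ) a ++ Denumerable.ofNat (List ℕ) b)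

theorem encode_append (l l' : List ℕ) : encode (l ++ l') = appendCode (encode l) (encode l') := by
  simp [appendCode]

theorem appendCode_zero (b : ℕ) : appendCode 0 b = b := by
  have := encode_append [] (Denumerable.ofNat (List ℕ) b)
  simpa using this.symm

theorem appendCode_consCode (x a b : ℕ) :
    appendCode (consCode x a) b = consCode x (appendCode a b) := by
  have h := encode_append (x :: Denumerable.ofNat (List ℕ) a) (Denumerable.ofNat (List ℕ) b)
  rw [List.cons_append, encode_cons, encode_cons, encode_append] at h
  simpa using h.symm

/-- The code of a term as a list of symbols. -/
def termCode {k : ℕ} (t : LA.Term (Empty ⊕ Fin k)) : ℕ := encode t.listEncode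

theorem termCode_var {k : ℕ} (i : Fin k) :
    termCode (&i : LA.Term (Empty ⊕ Fin k)) = consCode (2 * (2 * i + 1)) 0 := rfl

theorem termCode_zeroT {k : ℕ} : termCode (zeroT : LA.Term (Empty ⊕ Fin k)) = consCode 1 0 := rfl

theorem termCode_succT {k : ℕ} (t : LA.Term (Empty ⊕ Fin k)) :
    termCode (succT t) = consCode 3 (termCode t) := by
  have h : (succT t).listEncode = Sum.inr ⟨1, ArithFunc.succ⟩ :: t.listEncode := by
    simp [succT, Term.listEncode, List.finRange_succ]
  rw [termCode, h, termCode, encode_list_cons]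
  rfl

theorem termCode_addT {k : ℕ} (t s : LA.Term (Empty ⊕ Fin k)) :
    termCode (addT t s) = consCode 5 (appendCode (termCode t) (termCode s)) := by
  have h : (addT t s).listEncode =
      Sum.inr ⟨2, ArithFunc.add⟩ :: (t.listEncode ++ s.listEncode) := by
    simp [addT, Term.listEncode, List.finRange_succ]
  rw [termCode, h, termCode, termCode, encode_list_cons, encode_eq_encode_map (_ ++ _),
    List.map_append, encode_append, ← encode_eq_encode_map, ← encode_eq_encode_map]
  rfl

theorem termCode_mulT {k : ℕ} (t s : LA.Term (Empty ⊕ Fin k)) :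
    termCode (mulT t s) = consCode 7 (appendCode (termCode t) (termCode s)) := by
  have h : (mulT t s).listEncode =
      Sum.inr ⟨2, ArithFunc.mul⟩ :: (t.listEncode ++ s.listEncode) := by
    simp [mulT, Term.listEncode, List.finRange_succ]
  rw [termCode, h, termCode, termCode, encode_list_cons, encode_eq_encode_map (_ ++ _),
    List.map_append, encode_append, ← encode_eq_encode_map, ← encode_eq_encode_map]
  rfl

/-- The code of `⊥` in context `k`. -/
def falsumCode (k : ℕ) : ℕ := consCode (2 * (2 * (k + 2) + 1) + 1) 0

/-- The code of an equation between coded terms. -/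
def equalCode (k t s : ℕ) : ℕ :=
  consCode (2 * Nat.pair k t) (consCode (2 * Nat.pair k s) 0)

/-- The code of an inequality between coded terms. -/
def leCode (k t s : ℕ) : ℕ := consCode 1 (consCode (2 * (2 * k + 1) + 1) (equalCode k t s))

/-- The code of an implication between coded formulas. -/
def impCode (a b : ℕ) : ℕ := consCode 3 (appendCode a b)

/-- The code of the universal quantification of a coded formula. -/
def allCode (a : ℕ) : ℕ := consCode 7 a

theorem godel_falsum {k : ℕ} : godel (⊥ : LA.BoundedFormula Empty k) = falsumCode k := rfl

theorem godel_equal {k : ℕ} (t s : LA.Term (Empty ⊕ Fin k)) :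
    godel (t =' s) = equalCode k (termCode t) (termCode s) := rfl

theorem godel_leF {k : ℕ} (t s : LA.Term (Empty ⊕ Fin k)) :
    godel (leF t s) = leCode k (termCode t) (termCode s) := rfl

theorem godel_imp {k : ℕ} (φ ψ : LA.BoundedFormula Empty k) :
    godel (φ ⟹ ψ) = impCode (godel φ) (godel ψ) := by
  have h : (φ ⟹ ψ).listEncode = Sum.inr (Sum.inr 0) :: (φ.listEncode ++ ψ.listEncode) := rfl
  rw [godel, h, godel, godel, encode_list_cons, encode_eq_encode_map (_ ++ _),
    List.map_append, encode_append, ← encode_eq_encode_map, ← encode_eq_encode_map]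
  rfl

theorem godel_all {k : ℕ} (φ : LA.BoundedFormula Empty (k + 1)) :
    godel φ.all = allCode (godel φ) := rfl

theorem godel_injective {k : ℕ} : Function.Injective (godel (k := k)) := fun φ ψ h => by
  have h' := listEncode_sigma_injective (L := LA) (α := Empty) (a₁ := ⟨k, φ⟩) (a₂ := ⟨k, ψ⟩)
    (encode_injective h)
  simpa using h'

theorem term_cases {α : Type} {motive : LA.Term α → Prop} (var : ∀ i, motive (Term.var i))
    (zero : motive zeroT) (succ : ∀ t, motive t → motive (succT t))
    (add : ∀ t s, motive t → motive s → motive (addT t s))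
    (mul : ∀ t s, motive t → motive s → motive (mulT t s)) (t : LA.Term α) : motive t := by
  induction t with
  | var i => exact var i
  | func f ts ih =>
    cases f with
    | zero => exact (Subsingleton.elim ![] ts) ▸ zero
    | succ =>
      have h : ts = ![ts 0] := by ext i; fin_cases i; rfl
      exact h ▸ succ _ (ih 0)
    | add =>
      have h : ts = ![ts 0, ts 1] := by ext i; fin_cases i <;> rfl
      exact h ▸ add _ _ (ih 0) (ih 1)
    | mul =>
      have h : ts = ![ts 0, ts 1] := by ext i; fin_cases i <;> rfl
      exact h ▸ mul _ _ (ih 0) (ih 1)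

theorem formula_cases {motive : ∀ {k}, LA.BoundedFormula Empty k → Prop}
    (falsum : ∀ k, motive (⊥ : LA.BoundedFormula Empty k))
    (equal : ∀ {k} (t s : LA.Term (Empty ⊕ Fin k)), motive (t =' s))
    (le : ∀ {k} (t s : LA.Term (Empty ⊕ Fin k)), motive (leF t s))
    (imp : ∀ {k} (φ ψ : LA.BoundedFormula Empty k), motive φ → motive ψ → motive (φ ⟹ ψ))
    (all : ∀ {k} (φ : LA.BoundedFormula Empty (k + 1)), motive φ → motive φ.all)
    {k : ℕ} (φ : LA.BoundedFormula Empty k) : motive φ := by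
  induction φ with
  | falsum => exact falsum _
  | equal t s => exact equal t s
  | rel R ts =>
    cases R with
    | le =>
      have h : ts = ![ts 0, ts 1] := by ext i; fin_cases i <;> rfl
      exact h ▸ le _ _
  | imp φ ψ h h' => exact imp φ ψ h h'
  | all φ h => exact all φ h

end Codes

section DefinabilityOfCodes

variable {n k : ℕ} {f g h : (Fin k → ℕ) → ℕ}

theorem SigmaFun.consCode (hf : SigmaFun n f) (hg : SigmaFun n g) :
    SigmaFun n fun v => consCode (f v) (g v) :=
  (hf.pair hg).succ

/-- The graph of `appendCode`, as generated by the recursion on the first list. -/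
theorem derivable_append_iff {x : ℕ} :
    Derivable (fun x => ∃ b, x = Nat.pair 0 (Nat.pair b b))
      (fun y _ x => ∃ a b c d, y = Nat.pair a (Nat.pair b c) ∧
        x = Nat.pair (GRNonRE.consCode d a) (Nat.pair b (GRNonRE.consCode d c))) x ↔
    ∃ a b, x = Nat.pair a (Nat.pair b (appendCode a b)) := by
  constructor
  · intro h
    induction h with
    | base h =>
      obtain ⟨b, rfl⟩ := h
      exact ⟨0, b, by rw [appendCode_zero]⟩
    | step _ _ s ih _ =>
      obtain ⟨a, b, c, d, rfl, rfl⟩ := s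
      obtain ⟨a', b', e⟩ := ih
      simp only [Nat.pair_eq_pair] at e
      obtain ⟨rfl, rfl, rfl⟩ := e
      exact ⟨_, _, by rw [appendCode_consCode]⟩
  · rintro ⟨a, b, rfl⟩
    obtain ⟨l, rfl⟩ : ∃ l : List ℕ, Encodable.encode l = a :=
      ⟨Denumerable.ofNat _ a, Denumerable.encode_ofNat a⟩
    induction l with
    | nil => exact .base ⟨b, by rw [Encodable.encode_list_nil, appendCode_zero]⟩
    | cons d l ih =>
      exact .step ih ih ⟨_, _, _, d, rfl, by rw [encode_cons, appendCode_consCode]⟩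

theorem SigmaFun.appendCode (hf : SigmaFun n f) (hg : SigmaFun n g) :
    SigmaFun n fun v => appendCode (f v) (g v) := by
  refine ⟨SigmaRel.congr (SigmaRel.derivable (B := fun x => ∃ b, x = Nat.pair 0 (Nat.pair b b))
    (S := fun y _ x => ∃ a b c d, y = Nat.pair a (Nat.pair b c) ∧
        x = Nat.pair (GRNonRE.consCode d a) (Nat.pair b (GRNonRE.consCode d c))) ?_ ?_
        (hf.weaken.pair (hg.weaken.pair (.var (Fin.last k))))) fun v => ?_⟩
  · repeat' first
      | apply SigmaFun.var
      | apply SigmaRel.ex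
      | apply SigmaRel.eq
      | apply SigmaFun.pair
      | apply SigmaFun.const
  · repeat' first
      | apply SigmaFun.var
      | apply SigmaRel.ex
      | apply SigmaRel.and
      | apply SigmaRel.eq
      | apply SigmaFun.pair
      | apply SigmaFun.consCode
  · rw [derivable_append_iff]
    simp only [Nat.pair_eq_pair]
    constructor
    · exact fun e => ⟨_, _, rfl, rfl, e⟩
    · rintro ⟨a, b, rfl, rfl, e⟩
      exact e

/-- `s` is an element of the list with code `l`. -/
def MemCode (s l : ℕ) : Prop := ∃ a b, l = appendCode a (consCode s b)

theorem memCode_encode {s : ℕ} {l : List ℕ} : MemCode s (Encodable.encode l) ↔ s ∈ l := by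
  rw [List.mem_iff_append]
  constructor
  · rintro ⟨a, b, h⟩
    obtain ⟨l₁, rfl⟩ : ∃ l : List ℕ, Encodable.encode l = a :=
      ⟨Denumerable.ofNat _ a, Denumerable.encode_ofNat a⟩
    obtain ⟨l₂, rfl⟩ : ∃ l : List ℕ, Encodable.encode l = b :=
      ⟨Denumerable.ofNat _ b, Denumerable.encode_ofNat b⟩
    rw [← encode_cons, ← encode_append] at h
    exact ⟨l₁, l₂, Encodable.encode_injective h⟩
  · rintro ⟨l₁, l₂, rfl⟩
    exact ⟨_, _, by rw [encode_append, encode_cons]⟩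

theorem SigmaRel.memCode (hf : SigmaFun n f) (hg : SigmaFun n g) :
    SigmaRel n fun v => MemCode (f v) (g v) :=
  .comp₂ (.ex (.ex (.eq (.var 1) (.appendCode (.var 2) (.consCode (.var 0) (.var 3)))))) hf hg

theorem SigmaFun.falsumCode (hf : SigmaFun n f) : SigmaFun n fun v => falsumCode (f v) :=
  .consCode (.succ (.mul (.const 2) (.succ (.mul (.const 2) (.add hf (.const 2)))))) (.const 0)

theorem SigmaFun.equalCode (hf : SigmaFun n f) (hg : SigmaFun n g) (hh : SigmaFun n h) :
    SigmaFun n fun v => equalCode (f v) (g v) (h v) :=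
  .consCode (.mul (.const 2) (.pair hf hg))
    (.consCode (.mul (.const 2) (.pair hf hh)) (.const 0))

theorem SigmaFun.leCode (hf : SigmaFun n f) (hg : SigmaFun n g) (hh : SigmaFun n h) :
    SigmaFun n fun v => leCode (f v) (g v) (h v) :=
  .consCode (.const 1) (.consCode (.succ (.mul (.const 2) (.succ (.mul (.const 2) hf))))
    (.equalCode hf hg hh))

theorem SigmaFun.impCode (hf : SigmaFun n f) (hg : SigmaFun n g) :
    SigmaFun n fun v => impCode (f v) (g v) :=
  .consCode (.const 3) (.appendCode hf hg)

theorem SigmaFun.allCode (hf : SigmaFun n f) : SigmaFun n fun v => allCode (f v) :=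
  .consCode (.const 7) hf

end DefinabilityOfCodes

section Names

/-- Names for the elements of a term model: closed terms built from witness names. -/
def Name : Type := ℕ

instance : LA.Structure Name where
  funMap {_} f := match f with
    | ArithFunc.zero => fun _ => Nat.pair 0 0
    | ArithFunc.succ => fun v => Nat.pair 1 (v 0)
    | ArithFunc.add => fun v => Nat.pair 2 (Nat.pair (v 0) (v 1))
    | ArithFunc.mul => fun v => Nat.pair 3 (Nat.pair (v 0) (v 1))
  RelMap _ _ := False

variable {k : ℕ}

/-- The name denoted by a term when the `i`-th variable denotes `Nat.beta e i`. -/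
def termName (e : ℕ) (t : LA.Term (Empty ⊕ Fin k)) : ℕ :=
  t.realize (M := Name) (Sum.elim Empty.elim fun i : Fin k => Nat.beta e i)

theorem termName_zeroT (e : ℕ) :
    termName e (zeroT : LA.Term (Empty ⊕ Fin k)) = Nat.pair 0 0 := rfl

theorem termName_succT (e : ℕ) (t : LA.Term (Empty ⊕ Fin k)) :
    termName e (succT t) = Nat.pair 1 (termName e t) := rfl

theorem termName_addT (e : ℕ) (t s : LA.Term (Empty ⊕ Fin k)) :
    termName e (addT t s) = Nat.pair 2 (Nat.pair (termName e t) (termName e s)) := rfl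

theorem termName_mulT (e : ℕ) (t s : LA.Term (Empty ⊕ Fin k)) :
    termName e (mulT t s) = Nat.pair 3 (Nat.pair (termName e t) (termName e s)) := rfl

/-- `t` codes a term in context `k` denoting the name `d` in the environment `e`. -/
def EvalsTo (k e t d : ℕ) : Prop :=
  ∃ τ : LA.Term (Empty ⊕ Fin k), termCode τ = t ∧ termName e τ = d

/-- The states `((k, e), (t, d))` generated by evaluating variables and the constant `0`. -/
def EvalBase (x : ℕ) : Prop :=
  (∃ k e i, i < k ∧ x = Nat.pair (Nat.pair k e)
    (Nat.pair (consCode (2 * (2 * i + 1)) 0) (Nat.beta e i))) ∨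
  ∃ c, x = Nat.pair c (Nat.pair (consCode 1 0) (Nat.pair 0 0))

/-- The states `((k, e), (t, d))` generated by evaluating compound terms. -/
def EvalStep (y z x : ℕ) : Prop :=
  ∃ c t d s d', y = Nat.pair c (Nat.pair t d) ∧ z = Nat.pair c (Nat.pair s d') ∧
    (x = Nat.pair c (Nat.pair (consCode 3 t) (Nat.pair 1 d)) ∨
      x = Nat.pair c (Nat.pair (consCode 5 (appendCode t s)) (Nat.pair 2 (Nat.pair d d'))) ∨
      x = Nat.pair c (Nat.pair (consCode 7 (appendCode t s)) (Nat.pair 3 (Nat.pair d d'))))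

theorem derivable_eval_iff {x : ℕ} : Derivable EvalBase EvalStep x ↔
    ∃ k e t d, x = Nat.pair (Nat.pair k e) (Nat.pair t d) ∧ EvalsTo k e t d := by
  constructor
  · intro h
    induction h with
    | base h =>
      rcases h with ⟨k, e, i, hi, rfl⟩ | ⟨c, rfl⟩
      · exact ⟨_, _, _, _, rfl, &⟨i, hi⟩, termCode_var _, rfl⟩
      · exact ⟨c.unpair.1, c.unpair.2, _, _, by rw [Nat.pair_unpair], zeroT,
          termCode_zeroT, termName_zeroT _⟩
    | step _ _ h ihy ihz =>
      obtain ⟨c, t, d, s, d', rfl, rfl, h⟩ := h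
      obtain ⟨k, e, _, _, hy, τ, rfl, rfl⟩ := ihy
      obtain ⟨k', e', _, _, hz, σ, rfl, rfl⟩ := ihz
      rw [Nat.pair_eq_pair, Nat.pair_eq_pair] at hy
      obtain ⟨rfl, rfl, rfl⟩ := hy
      simp only [Nat.pair_eq_pair] at hz
      obtain ⟨⟨rfl, rfl⟩, rfl, rfl⟩ := hz
      rcases h with rfl | rfl | rfl
      · exact ⟨_, _, _, _, rfl, succT τ, termCode_succT _, termName_succT _ _⟩
      · exact ⟨_, _, _, _, rfl, addT τ σ, termCode_addT _ _, termName_addT _ _ _⟩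
      · exact ⟨_, _, _, _, rfl, mulT τ σ, termCode_mulT _ _, termName_mulT _ _ _⟩
  · rintro ⟨k, e, _, _, rfl, τ, rfl, rfl⟩
    induction τ using term_cases with
    | var i =>
      rcases i with i | i
      · exact i.elim
      · exact .base (.inl ⟨k, e, i, i.2, rfl⟩)
    | zero => exact .base (.inr ⟨_, rfl⟩)
    | succ t ih =>
      refine .step ih ih ⟨_, _, _, _, _, rfl, rfl, .inl ?_⟩
      rw [termCode_succT, termName_succT]
    | add t s ih ih' =>
      refine .step ih ih' ⟨_, _, _, _, _, rfl, rfl, .inr (.inl ?_)⟩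
      rw [termCode_addT, termName_addT]
    | mul t s ih ih' =>
      refine .step ih ih' ⟨_, _, _, _, _, rfl, rfl, .inr (.inr ?_)⟩
      rw [termCode_mulT, termName_mulT]

/-- `a` codes a formula in context `k`. -/
def IsFormulaCode (k a : ℕ) : Prop := ∃ φ : LA.BoundedFormula Empty k, godel φ = a

/-- The pairs `(k, a)` with `a` the code of an atomic formula in context `k`. -/
def FormulaBase (x : ℕ) : Prop :=
  (∃ k, x = Nat.pair k (falsumCode k)) ∨
  ∃ k t s d d', EvalsTo k 0 t d ∧ EvalsTo k 0 s d' ∧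
    (x = Nat.pair k (equalCode k t s) ∨ x = Nat.pair k (leCode k t s))

/-- The formation rules for compound formulas. -/
def FormulaStep (y z x : ℕ) : Prop :=
  (∃ k a b, y = Nat.pair k a ∧ z = Nat.pair k b ∧ x = Nat.pair k (impCode a b)) ∨
  ∃ k a, y = Nat.pair (k + 1) a ∧ x = Nat.pair k (allCode a)

theorem derivable_formula_iff {x : ℕ} : Derivable FormulaBase FormulaStep x ↔
    ∃ k a, x = Nat.pair k a ∧ IsFormulaCode k a := by
  constructor
  · intro h
    induction h with
    | base h =>
      rcases h with ⟨k, rfl⟩ | ⟨k, _, _, _, _, ⟨τ, rfl, -⟩, ⟨σ, rfl, -⟩, rfl | rfl⟩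
      · exact ⟨_, _, rfl, ⊥, rfl⟩
      · exact ⟨_, _, rfl, τ =' σ, rfl⟩
      · exact ⟨_, _, rfl, leF τ σ, rfl⟩
    | step _ _ h ihy ihz =>
      obtain ⟨k', _, hy, φ, rfl⟩ := ihy
      obtain ⟨k'', _, hz, ψ, rfl⟩ := ihz
      rcases h with ⟨k, a, b, rfl, rfl, rfl⟩ | ⟨k, a, rfl, rfl⟩
      · simp only [Nat.pair_eq_pair] at hy hz
        obtain ⟨rfl, rfl⟩ := hy
        obtain ⟨rfl, rfl⟩ := hz
        exact ⟨_, _, rfl, φ ⟹ ψ, godel_imp _ _⟩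
      · simp only [Nat.pair_eq_pair] at hy
        obtain ⟨rfl, rfl⟩ := hy
        exact ⟨_, _, rfl, φ.all, rfl⟩
  · rintro ⟨k, _, rfl, φ, rfl⟩
    induction φ using formula_cases with
    | falsum k => exact .base (.inl ⟨_, rfl⟩)
    | equal t s => exact .base (.inr ⟨_, _, _, _, _, ⟨t, rfl, rfl⟩, ⟨s, rfl, rfl⟩, .inl rfl⟩)
    | le t s => exact .base (.inr ⟨_, _, _, _, _, ⟨t, rfl, rfl⟩, ⟨s, rfl, rfl⟩, .inr rfl⟩)
    | imp φ ψ h h' => exact .step h h' (.inl ⟨_, _, _, rfl, rfl, by rw [godel_imp]⟩)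
    | all φ h => exact .step h h (.inr ⟨_, _, rfl, rfl⟩)

end Names

section DefinabilityOfEvaluation

variable {n k : ℕ} {f₁ f₂ f₃ f₄ : (Fin k → ℕ) → ℕ}

theorem SigmaRel.evalsTo (h₁ : SigmaFun n f₁) (h₂ : SigmaFun n f₂) (h₃ : SigmaFun n f₃)
    (h₄ : SigmaFun n f₄) : SigmaRel n fun v => EvalsTo (f₁ v) (f₂ v) (f₃ v) (f₄ v) := by
  refine SigmaRel.congr (SigmaRel.derivable (B := EvalBase) (S := EvalStep) ?_ ?_
    (.pair (.pair h₁ h₂) (.pair h₃ h₄))) fun v => ?_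
  · unfold EvalBase
    repeat' first
      | apply SigmaFun.var
      | apply SigmaRel.ex
      | apply SigmaRel.and
      | apply SigmaRel.or
      | apply SigmaRel.eq
      | apply SigmaRel.lt
      | apply SigmaFun.const
      | apply SigmaFun.pair
      | apply SigmaFun.consCode
      | apply SigmaFun.beta
      | apply SigmaFun.succ
      | apply SigmaFun.mul
  · unfold EvalStep
    repeat' first
      | apply SigmaFun.var
      | apply SigmaRel.ex
      | apply SigmaRel.and
      | apply SigmaRel.or
      | apply SigmaRel.eq
      | apply SigmaFun.const
      | apply SigmaFun.pair
      | apply SigmaFun.consCode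
      | apply SigmaFun.appendCode
  · rw [derivable_eval_iff]
    simp only [Nat.pair_eq_pair]
    constructor
    · exact fun h => ⟨_, _, _, _, ⟨⟨rfl, rfl⟩, rfl, rfl⟩, h⟩
    · rintro ⟨_, _, _, _, ⟨⟨rfl, rfl⟩, rfl, rfl⟩, h⟩
      exact h

theorem SigmaRel.isFormulaCode (h₁ : SigmaFun n f₁) (h₂ : SigmaFun n f₂) :
    SigmaRel n fun v => IsFormulaCode (f₁ v) (f₂ v) := by
  refine SigmaRel.congr (SigmaRel.derivable (B := FormulaBase) (S := FormulaStep) ?_ ?_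
    (.pair h₁ h₂)) fun v => ?_
  · unfold FormulaBase
    repeat' first
      | apply SigmaFun.var
      | apply SigmaRel.evalsTo
      | apply SigmaRel.ex
      | apply SigmaRel.and
      | apply SigmaRel.or
      | apply SigmaRel.eq
      | apply SigmaFun.const
      | apply SigmaFun.pair
      | apply SigmaFun.falsumCode
      | apply SigmaFun.equalCode
      | apply SigmaFun.leCode
  · unfold FormulaStep
    repeat' first
      | apply SigmaFun.var
      | apply SigmaRel.ex
      | apply SigmaRel.and
      | apply SigmaRel.or
      | apply SigmaRel.eq
      | apply SigmaFun.pair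
      | apply SigmaFun.impCode
      | apply SigmaFun.allCode
      | apply SigmaFun.succ
  · rw [derivable_formula_iff]
    simp only [Nat.pair_eq_pair]
    constructor
    · exact fun h => ⟨_, _, ⟨rfl, rfl⟩, h⟩
    · rintro ⟨_, _, ⟨rfl, rfl⟩, h⟩
      exact h

end DefinabilityOfEvaluation

section Clashes

/-- The assertion that the formula coded by `a` in context `k` holds in the environment `e`. -/
def holdsAtom (k a e : ℕ) : ℕ := Nat.pair 0 (Nat.pair (Nat.pair k a) e)

/-- The assertion that two names are equal. -/
def eqAtom (a b : ℕ) : ℕ := Nat.pair 1 (Nat.pair a b)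

/-- The assertion that one name is at most another. -/
def leAtom (a b : ℕ) : ℕ := Nat.pair 2 (Nat.pair a b)

/-- The name of a counterexample to the universal assertion `a`. -/
def witnessName (a : ℕ) : ℕ := Nat.pair 4 a

/-- The environments `e` and `e'` agree on the first `k` variables. -/
def AgreeBelow (k e e' : ℕ) : Prop := ∀ i ≤ k, k ≤ i ∨ Nat.beta e' i = Nat.beta e i

/-- Asserting `P` and denying `N` violates consistency or the truth of the axioms of `T`. -/
def AxiomClash (T : LA.Theory) (P N : ℕ → Prop) : Prop :=
  (∃ a, P a ∧ N a) ∨ ∃ a e, a ∈ axiomCodes T ∧ N (holdsAtom 0 a e)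

/-- Asserting `P` and denying `N` violates the truth conditions of a connective. -/
def ConnectiveClash (P N : ℕ → Prop) : Prop :=
  (∃ k e, P (holdsAtom k (falsumCode k) e)) ∨
  ∃ k a b e, IsFormulaCode k a ∧ IsFormulaCode k b ∧
    ((P (holdsAtom k (impCode a b) e) ∧ P (holdsAtom k a e) ∧ N (holdsAtom k b e)) ∨
      (N (holdsAtom k (impCode a b) e) ∧ P (holdsAtom k b e)) ∨
      (N (holdsAtom k (impCode a b) e) ∧ N (holdsAtom k a e)))

/-- Asserting `P` and denying `N` violates the truth conditions of the quantifier. -/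
def QuantifierClash (P N : ℕ → Prop) : Prop :=
  ∃ k a e e', IsFormulaCode (k + 1) a ∧ AgreeBelow k e e' ∧
    ((P (holdsAtom k (allCode a) e) ∧ N (holdsAtom (k + 1) a e')) ∨
      (Nat.beta e' k = witnessName (holdsAtom k (allCode a) e) ∧
        N (holdsAtom k (allCode a) e) ∧ P (holdsAtom (k + 1) a e')))

/-- Asserting `P` and denying `N` violates the truth conditions of an atomic formula. -/
def AtomicClash (P N : ℕ → Prop) : Prop :=
  ∃ k e t s a b, EvalsTo k e t a ∧ EvalsTo k e s b ∧
    ((P (holdsAtom k (equalCode k t s) e) ∧ N (eqAtom a b)) ∨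
      (N (holdsAtom k (equalCode k t s) e) ∧ P (eqAtom a b)) ∨
      (P (holdsAtom k (leCode k t s) e) ∧ N (leAtom a b)) ∨
      (N (holdsAtom k (leCode k t s) e) ∧ P (leAtom a b)))

/-- Asserting `P` and denying `N` violates the laws of equality. -/
def EqualityClash (P N : ℕ → Prop) : Prop :=
  (∃ a, N (eqAtom a a)) ∨
  (∃ a b c, P (eqAtom a b) ∧ P (eqAtom a c) ∧ N (eqAtom b c)) ∨
  (∃ a b, P (eqAtom a b) ∧ N (eqAtom (Nat.pair 1 a) (Nat.pair 1 b))) ∨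
  ∃ a b c d, P (eqAtom a b) ∧ P (eqAtom c d) ∧
    (N (eqAtom (Nat.pair 2 (Nat.pair a c)) (Nat.pair 2 (Nat.pair b d))) ∨
      N (eqAtom (Nat.pair 3 (Nat.pair a c)) (Nat.pair 3 (Nat.pair b d))) ∨
      (P (leAtom a c) ∧ N (leAtom b d)))

/-- Asserting `P` and denying `N` violates a rule that every valuation obtained from a
model of `T` satisfies. -/
def Clash (T : LA.Theory) (P N : ℕ → Prop) : Prop :=
  AxiomClash T P N ∨ ConnectiveClash P N ∨ QuantifierClash P N ∨ AtomicClash P N ∨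
    EqualityClash P N

variable {T : LA.Theory}

/-- A clash involves only finitely many assertions, so it occurs at some stage of an
increasing union. -/
theorem Clash.exists_stage {P N : ℕ → ℕ → Prop} (hP : ∀ {i j a}, i ≤ j → P i a → P j a)
    (hN : ∀ {i j a}, i ≤ j → N i a → N j a)
    (h : Clash T (fun a => ∃ i, P i a) fun a => ∃ i, N i a) : ∃ i, Clash T (P i) (N i) := by
  have key : ∀ {X Y : ℕ → Prop}, (∀ {i j}, i ≤ j → X i → X j) → (∀ {i j}, i ≤ j → Y i → Y j) →
      (∃ i, X i) → (∃ i, Y i) → ∃ i, X i ∧ Y i := fun hX hY ⟨i, hi⟩ ⟨j, hj⟩ =>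
    ⟨max i j, hX (le_max_left _ _) hi, hY (le_max_right _ _) hj⟩
  have key₃ : ∀ {X Y Z : ℕ → Prop}, (∀ {i j}, i ≤ j → X i → X j) →
      (∀ {i j}, i ≤ j → Y i → Y j) → (∀ {i j}, i ≤ j → Z i → Z j) →
      (∃ i, X i) → (∃ i, Y i) → (∃ i, Z i) → ∃ i, X i ∧ Y i ∧ Z i := fun hX hY hZ h₁ h₂ h₃ =>
    key hX (fun l h => ⟨hY l h.1, hZ l h.2⟩) h₁ (key hY hZ h₂ h₃)
  rcases h with h | h | h | h | h
  · rcases h with ⟨a, h₁, h₂⟩ | ⟨a, e, ha, i, h⟩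
    · exact (key hP hN h₁ h₂).imp fun i h => .inl (.inl ⟨a, h⟩)
    · exact ⟨i, .inl (.inr ⟨a, e, ha, h⟩)⟩
  · rcases h with ⟨k, e, i, h⟩ | ⟨k, a, b, e, ha, hb, h⟩
    · exact ⟨i, .inr (.inl (.inl ⟨k, e, h⟩))⟩
    · rcases h with ⟨h₁, h₂, h₃⟩ | ⟨h₁, h₂⟩ | ⟨h₁, h₂⟩
      · exact (key₃ hP hP hN h₁ h₂ h₃).imp fun i h =>
          .inr (.inl (.inr ⟨k, a, b, e, ha, hb, .inl h⟩))
      · exact (key hN hP h₁ h₂).imp fun i h =>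
          .inr (.inl (.inr ⟨k, a, b, e, ha, hb, .inr (.inl h)⟩))
      · exact (key hN hN h₁ h₂).imp fun i h =>
          .inr (.inl (.inr ⟨k, a, b, e, ha, hb, .inr (.inr h)⟩))
  · obtain ⟨k, a, e, e', ha, he, ⟨h₁, h₂⟩ | ⟨hw, h₁, h₂⟩⟩ := h
    · exact (key hP hN h₁ h₂).imp fun i h => .inr (.inr (.inl ⟨k, a, e, e', ha, he, .inl h⟩))
    · exact (key hN hP h₁ h₂).imp fun i h =>
        .inr (.inr (.inl ⟨k, a, e, e', ha, he, .inr ⟨hw, h⟩⟩))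
  · obtain ⟨k, e, t, s, a, b, ht, hs, h⟩ := h
    suffices h' : ∃ i, _ from h'.imp fun i h =>
      .inr (.inr (.inr (.inl ⟨k, e, t, s, a, b, ht, hs, h⟩)))
    rcases h with ⟨h₁, h₂⟩ | ⟨h₁, h₂⟩ | ⟨h₁, h₂⟩ | ⟨h₁, h₂⟩
    · exact (key hP hN h₁ h₂).imp fun i h => .inl h
    · exact (key hN hP h₁ h₂).imp fun i h => .inr (.inl h)
    · exact (key hP hN h₁ h₂).imp fun i h => .inr (.inr (.inl h))
    · exact (key hN hP h₁ h₂).imp fun i h => .inr (.inr (.inr h))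
  · suffices h' : ∃ i, EqualityClash (P i) (N i) from h'.imp fun i h =>
      .inr (.inr (.inr (.inr h)))
    rcases h with ⟨a, i, h⟩ | ⟨a, b, c, h₁, h₂, h₃⟩ | ⟨a, b, h₁, h₂⟩ | ⟨a, b, c, d, h₁, h₂, h⟩
    · exact ⟨i, .inl ⟨a, h⟩⟩
    · exact (key₃ hP hP hN h₁ h₂ h₃).imp fun i h => .inr (.inl ⟨a, b, c, h⟩)
    · exact (key hP hN h₁ h₂).imp fun i h => .inr (.inr (.inl ⟨a, b, h⟩))
    · suffices h' : ∃ i, _ ∧ _ ∧ _ from h'.imp fun i h => .inr (.inr (.inr ⟨a, b, c, d, h⟩))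
      rcases h with h₃ | h₃ | ⟨h₃, h₄⟩
      · exact (key₃ hP hP hN h₁ h₂ h₃).imp fun i h => ⟨h.1, h.2.1, .inl h.2.2⟩
      · exact (key₃ hP hP hN h₁ h₂ h₃).imp fun i h => ⟨h.1, h.2.1, .inr (.inl h.2.2)⟩
      · exact (key₃ hP hP (fun l h => ⟨hP l h.1, hN l h.2⟩) h₁ h₂ (key hP hN h₃ h₄)).imp
          fun i h => ⟨h.1, h.2.1, .inr (.inr h.2.2)⟩

theorem Clash.mono {P N P' N' : ℕ → Prop} (h : Clash T P N) (hP : ∀ a, P a → P' a)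
    (hN : ∀ a, N a → N' a) : Clash T P' N' := by
  revert h
  unfold Clash AxiomClash ConnectiveClash QuantifierClash AtomicClash EqualityClash
  repeat' first
    | exact hP _
    | exact hN _
    | exact id
    | apply Or.imp
    | apply And.imp
    | refine Exists.imp fun _ => ?_

end Clashes

section Refutations

variable {T : LA.Theory}

/-- The coded list `x` of signed assertions (`2 * a + 1` asserts and `2 * a` denies `a`) is
refuted by clashes and case distinctions. -/
def Refutable (T : LA.Theory) : ℕ → Prop :=
  Derivable (fun x => Clash T (fun a => MemCode (2 * a + 1) x) fun a => MemCode (2 * a) x)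
    fun y z x => ∃ a, y = consCode (2 * a + 1) x ∧ z = consCode (2 * a) x

/-- The valuation `W` agrees with the coded list `x` of signed assertions. -/
def Satisfies (W : ℕ → Prop) (x : ℕ) : Prop :=
  (∀ a, MemCode (2 * a + 1) x → W a) ∧ ∀ a, MemCode (2 * a) x → ¬ W a

theorem memCode_consCode {s d x : ℕ} : MemCode s (consCode d x) ↔ s = d ∨ MemCode s x := by
  obtain ⟨l, rfl⟩ : ∃ l : List ℕ, Encodable.encode l = x :=
    ⟨Denumerable.ofNat _ x, Denumerable.encode_ofNat x⟩
  rw [← encode_cons, memCode_encode, memCode_encode, List.mem_cons]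

theorem Refutable.not_satisfies {x : ℕ} {W : ℕ → Prop} (hW : ¬ Clash T W fun a => ¬ W a)
    (h : Refutable T x) : ¬ Satisfies W x := by
  induction h with
  | base h => exact fun hx => hW (h.mono hx.1 hx.2)
  | step _ _ s ihy ihz =>
    obtain ⟨a, rfl, rfl⟩ := s
    intro hx
    by_cases ha : W a
    · refine ihy ⟨fun b hb => ?_, fun b hb => ?_⟩ <;> rcases memCode_consCode.1 hb with e | hb
      · rwa [show b = a by omega]
      · exact hx.1 b hb
      · omega
      · exact hx.2 b hb
    · refine ihz ⟨fun b hb => ?_, fun b hb => ?_⟩ <;> rcases memCode_consCode.1 hb with e | hb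
      · omega
      · exact hx.1 b hb
      · rwa [show b = a by omega]
      · exact hx.2 b hb

open Classical in
/-- Decide the assertions one by one while staying irrefutable. -/
noncomputable def saturate (T : LA.Theory) (x : ℕ) : ℕ → ℕ
  | 0 => x
  | m + 1 => if Refutable T (consCode (2 * m + 1) (saturate T x m))
      then consCode (2 * m) (saturate T x m) else consCode (2 * m + 1) (saturate T x m)

theorem not_refutable_saturate {x : ℕ} (hx : ¬ Refutable T x) :
    ∀ m, ¬ Refutable T (saturate T x m)
  | 0 => hx
  | m + 1 => by
    rw [saturate]
    split_ifs with h
    · exact fun h' => not_refutable_saturate hx m (.step h h' ⟨m, rfl, rfl⟩)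
    · exact h

theorem memCode_saturate_mono {x s i j : ℕ} (hij : i ≤ j) (h : MemCode s (saturate T x i)) :
    MemCode s (saturate T x j) := by
  induction j, hij using Nat.le_induction with
  | base => exact h
  | succ j _ ih =>
    rw [saturate]
    split_ifs <;> exact memCode_consCode.2 (.inr ih)

theorem memCode_saturate_succ (T : LA.Theory) (x m : ℕ) :
    MemCode (2 * m + 1) (saturate T x (m + 1)) ∨ MemCode (2 * m) (saturate T x (m + 1)) := by
  rw [saturate]
  split_ifs
  · exact .inr (memCode_consCode.2 (.inl rfl))
  · exact .inl (memCode_consCode.2 (.inl rfl))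

theorem exists_satisfies {x : ℕ} (hx : ¬ Refutable T x) :
    ∃ W : ℕ → Prop, (¬ Clash T W fun a => ¬ W a) ∧ Satisfies W x := by
  refine ⟨fun a => ∃ m, MemCode (2 * a + 1) (saturate T x m), fun h => ?_,
    fun a h => ⟨0, h⟩, fun a h ⟨m, h'⟩ => ?_⟩
  · have h' : Clash T (fun a => ∃ m, MemCode (2 * a + 1) (saturate T x m))
        fun a => ∃ m, MemCode (2 * a) (saturate T x m) :=
      h.mono (fun _ => id) fun a ha => ⟨a + 1, (memCode_saturate_succ T x a).resolve_left
        fun h => ha ⟨_, h⟩⟩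
    obtain ⟨m, h''⟩ := Clash.exists_stage
      (P := fun m a => MemCode (2 * a + 1) (saturate T x m))
      (N := fun m a => MemCode (2 * a) (saturate T x m))
      memCode_saturate_mono memCode_saturate_mono h'
    exact not_refutable_saturate hx m (.base h'')
  · exact not_refutable_saturate hx m
      (.base (.inl (.inl ⟨a, h', memCode_saturate_mono (Nat.zero_le m) h⟩)))

end Refutations

section DefinabilityOfRefutations

variable {n k : ℕ} {T : LA.Theory} {f g h : (Fin k → ℕ) → ℕ}

theorem SigmaFun.holdsAtom (hf : SigmaFun n f) (hg : SigmaFun n g) (hh : SigmaFun n h) :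
    SigmaFun n fun v => holdsAtom (f v) (g v) (h v) :=
  .pair (.const 0) (.pair (.pair hf hg) hh)

theorem SigmaFun.eqAtom (hf : SigmaFun n f) (hg : SigmaFun n g) :
    SigmaFun n fun v => eqAtom (f v) (g v) :=
  .pair (.const 1) (.pair hf hg)

theorem SigmaFun.leAtom (hf : SigmaFun n f) (hg : SigmaFun n g) :
    SigmaFun n fun v => leAtom (f v) (g v) :=
  .pair (.const 2) (.pair hf hg)

theorem SigmaRel.agreeBelow (hf : SigmaFun n f) (hg : SigmaFun n g) (hh : SigmaFun n h) :
    SigmaRel n fun v => AgreeBelow (f v) (g v) (h v) :=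
  .comp₃ (.ball (.var 0) (.or (.le (.var 0) (.var 3))
    (.eq (.beta (.var 2) (.var 3)) (.beta (.var 1) (.var 3))))) hf hg hh

theorem SigmaRel.axiomCodes (hT : PiDefinable n (axiomCodes T)) (hf : SigmaFun n f) :
    SigmaRel n fun v => f v ∈ axiomCodes T := by
  obtain ⟨Ψ, hΨ, hd⟩ := hT
  refine .comp₁ (P := fun x => x ∈ GRNonRE.axiomCodes T) ⟨Ψ, .ofPi hΨ, fun v => ?_⟩ hf
  have hv : v = ![v 0] := by ext i; fin_cases i; rfl
  rw [← Subsingleton.elim (fun e => Empty.elim e) default, hv]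
  exact (hd _).symm

theorem SigmaRel.clash (hT : PiDefinable n (GRNonRE.axiomCodes T)) :
    SigmaRel n fun v : Fin 1 → ℕ =>
      Clash T (fun a => MemCode (2 * a + 1) (v 0)) fun a => MemCode (2 * a) (v 0) := by
  unfold Clash AxiomClash ConnectiveClash QuantifierClash AtomicClash EqualityClash witnessName
  repeat' first
    | apply SigmaFun.var
    | apply SigmaRel.memCode
    | apply SigmaRel.evalsTo
    | apply SigmaRel.isFormulaCode
    | apply SigmaRel.agreeBelow
    | apply SigmaRel.axiomCodes hT
    | apply SigmaRel.ex
    | apply SigmaRel.and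
    | apply SigmaRel.or
    | apply SigmaRel.eq
    | apply SigmaFun.const
    | apply SigmaFun.holdsAtom
    | apply SigmaFun.eqAtom
    | apply SigmaFun.leAtom
    | apply SigmaFun.falsumCode
    | apply SigmaFun.impCode
    | apply SigmaFun.allCode
    | apply SigmaFun.equalCode
    | apply SigmaFun.leCode
    | apply SigmaFun.pair
    | apply SigmaFun.beta
    | apply SigmaFun.succ
    | apply SigmaFun.mul

theorem SigmaRel.refutable (hT : PiDefinable n (GRNonRE.axiomCodes T)) (hf : SigmaFun n f) :
    SigmaRel n fun v => Refutable T (f v) :=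
  .derivable (.clash hT) (.ex (.and
    (.eq (.var 0) (.consCode (.succ (.mul (.const 2) (.var 3))) (.var 2)))
    (.eq (.var 1) (.consCode (.mul (.const 2) (.var 3)) (.var 2))))) hf

end DefinabilityOfRefutations

section Environments

theorem exists_extension (k e d : ℕ) : ∃ e', AgreeBelow k e e' ∧ Nat.beta e' k = d := by
  let l := (List.range k).map (Nat.beta e) ++ [d]
  have hl : l.length = k + 1 := by simp [l]
  have h : ∀ i (hi : i < k + 1), Nat.beta (Nat.unbeta l) i = l[i] := fun i hi =>
    Nat.beta_unbeta_coe l ⟨i, by omega⟩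
  refine ⟨Nat.unbeta l, fun i hi => ?_, ?_⟩
  · rcases hi.lt_or_eq with hi | rfl
    · right
      rw [h i (by omega)]
      simp [l, hi]
    · exact .inl le_rfl
  · rw [h k (by omega)]
    simp [l]

theorem AgreeBelow.env_eq_snoc {M : Type} {k e e' : ℕ} (h : AgreeBelow k e e') (q : ℕ → M) :
    (fun i : Fin (k + 1) => q (Nat.beta e' i)) =
      Fin.snoc (fun i : Fin k => q (Nat.beta e i)) (q (Nat.beta e' k)) := by
  funext i
  refine Fin.lastCases ?_ (fun i => ?_) i
  · simp
  · have := (h i i.2.le).resolve_left (by omega)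
    simp [this]

end Environments

section TermModel

variable {T : LA.Theory} {W : ℕ → Prop}

theorem eqAtom_refl (hW : ¬ Clash T W fun a => ¬ W a) (a : ℕ) : W (eqAtom a a) := by
  by_contra h
  exact hW (.inr (.inr (.inr (.inr (.inl ⟨a, h⟩)))))

theorem eqAtom_euclid (hW : ¬ Clash T W fun a => ¬ W a) {a b c : ℕ} (hb : W (eqAtom a b))
    (hc : W (eqAtom a c)) : W (eqAtom b c) := by
  by_contra h
  exact hW (.inr (.inr (.inr (.inr (.inr (.inl ⟨a, b, c, hb, hc, h⟩))))))

theorem eqAtom_symm (hW : ¬ Clash T W fun a => ¬ W a) {a b : ℕ} (h : W (eqAtom a b)) :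
    W (eqAtom b a) :=
  eqAtom_euclid hW h (eqAtom_refl hW a)

/-- Equality of names according to the valuation `W`. -/
def nameSetoid (hW : ¬ Clash T W fun a => ¬ W a) : Setoid ℕ where
  r a b := W (eqAtom a b)
  iseqv := ⟨eqAtom_refl hW, eqAtom_symm hW, fun h h' => eqAtom_euclid hW (eqAtom_symm hW h) h'⟩

/-- The term model described by the valuation `W`. -/
def TermModel (hW : ¬ Clash T W fun a => ¬ W a) : Type := Quotient (nameSetoid hW)

/-- The element of the term model with a given name. -/
def TermModel.mk (hW : ¬ Clash T W fun a => ¬ W a) (a : ℕ) : TermModel hW :=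
  Quotient.mk (nameSetoid hW) a

/-- A name for an element of the term model. -/
noncomputable def TermModel.name {hW : ¬ Clash T W fun a => ¬ W a} (x : TermModel hW) : ℕ :=
  Quotient.out x

variable (hW : ¬ Clash T W fun a => ¬ W a)

noncomputable instance : LA.Structure (TermModel hW) where
  funMap {_} f := match f with
    | ArithFunc.zero => fun _ => .mk hW (Nat.pair 0 0)
    | ArithFunc.succ => fun v => .mk hW (Nat.pair 1 (v 0).name)
    | ArithFunc.add => fun v => .mk hW (Nat.pair 2 (Nat.pair (v 0).name (v 1).name))
    | ArithFunc.mul => fun v => .mk hW (Nat.pair 3 (Nat.pair (v 0).name (v 1).name))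
  RelMap {_} r := match r with
    | ArithRel.le => fun v => W (leAtom (v 0).name (v 1).name)

instance : Nonempty (TermModel hW) := ⟨.mk hW 0⟩

theorem TermModel.mk_eq_mk {a b : ℕ} :
    TermModel.mk hW a = TermModel.mk hW b ↔ W (eqAtom a b) :=
  Quotient.eq (r := nameSetoid hW)

theorem TermModel.mk_name (x : TermModel hW) : TermModel.mk hW x.name = x :=
  Quotient.out_eq x

theorem TermModel.eqAtom_name (a : ℕ) : W (eqAtom (TermModel.mk hW a).name a) :=
  (TermModel.mk_eq_mk hW).1 (TermModel.mk_name hW _)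

theorem TermModel.leAtom_name (a b : ℕ) :
    W (leAtom (TermModel.mk hW a).name (TermModel.mk hW b).name) ↔ W (leAtom a b) := by
  have key : ∀ {a b c d : ℕ}, W (eqAtom a b) → W (eqAtom c d) → W (leAtom a c) →
      W (leAtom b d) := fun {a b c d} h h' h'' => by
    by_contra hn
    exact hW (.inr (.inr (.inr (.inr (.inr (.inr (.inr
      ⟨a, b, c, d, h, h', .inr (.inr ⟨h'', hn⟩)⟩)))))))
  exact ⟨key (eqAtom_name hW a) (eqAtom_name hW b),
    key (eqAtom_symm hW (eqAtom_name hW a)) (eqAtom_symm hW (eqAtom_name hW b))⟩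

theorem TermModel.realize_term {k : ℕ} (e : ℕ) (t : LA.Term (Empty ⊕ Fin k)) :
    t.realize (Sum.elim default fun i : Fin k => TermModel.mk hW (Nat.beta e i)) =
      TermModel.mk hW (termName e t) := by
  induction t using term_cases with
  | var i =>
    rcases i with i | i
    · exact i.elim
    · rfl
  | zero => rfl
  | succ t ih =>
    rw [termName_succT]
    refine Eq.trans (congrArg (fun x : TermModel hW => mk hW (Nat.pair 1 x.name)) ih) ?_
    rw [mk_eq_mk]
    by_contra h
    exact hW (.inr (.inr (.inr (.inr (.inr (.inr (.inl ⟨_, _, eqAtom_name hW _, h⟩)))))))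
  | add t s ih ih' =>
    rw [termName_addT]
    refine Eq.trans (congrArg₂ (fun x y : TermModel hW =>
      mk hW (Nat.pair 2 (Nat.pair x.name y.name))) ih ih') ?_
    rw [mk_eq_mk]
    by_contra h
    exact hW (.inr (.inr (.inr (.inr (.inr (.inr (.inr
      ⟨_, _, _, _, eqAtom_name hW _, eqAtom_name hW _, .inl h⟩)))))))
  | mul t s ih ih' =>
    rw [termName_mulT]
    refine Eq.trans (congrArg₂ (fun x y : TermModel hW =>
      mk hW (Nat.pair 3 (Nat.pair x.name y.name))) ih ih') ?_
    rw [mk_eq_mk]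
    by_contra h
    exact hW (.inr (.inr (.inr (.inr (.inr (.inr (.inr
      ⟨_, _, _, _, eqAtom_name hW _, eqAtom_name hW _, .inr (.inl h)⟩)))))))

theorem TermModel.realize_formula {k : ℕ} (φ : LA.BoundedFormula Empty k) (e : ℕ) :
    φ.Realize default (fun i : Fin k => TermModel.mk hW (Nat.beta e i)) ↔
      W (holdsAtom k (godel φ) e) := by
  induction φ using formula_cases generalizing e with
  | falsum k =>
    refine iff_of_false id fun h => ?_
    exact hW (.inr (.inl (.inl ⟨k, e, h⟩)))
  | @equal k t s =>
    rw [realize_bdEqual, realize_term, realize_term, mk_eq_mk, godel_equal]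
    have h := fun h => hW (.inr (.inr (.inr (.inl
      ⟨k, e, _, _, _, _, ⟨t, rfl, rfl⟩, ⟨s, rfl, rfl⟩, h⟩))))
    constructor <;> intro h₁ <;> by_contra h₂
    · exact h (.inr (.inl ⟨h₂, h₁⟩))
    · exact h (.inl ⟨h₁, h₂⟩)
  | @le k t s =>
    have e' : (leF t s).Realize default (fun i : Fin k => TermModel.mk hW (Nat.beta e i)) ↔
        W (leAtom
          (t.realize (Sum.elim default fun i : Fin k => TermModel.mk hW (Nat.beta e i))).name
          (s.realize (Sum.elim default fun i : Fin k => TermModel.mk hW (Nat.beta e i))).name) :=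
      Iff.rfl
    rw [e', realize_term, realize_term, leAtom_name hW, godel_leF]
    have h := fun h => hW (.inr (.inr (.inr (.inl
      ⟨k, e, _, _, _, _, ⟨t, rfl, rfl⟩, ⟨s, rfl, rfl⟩, h⟩))))
    constructor <;> intro h₁ <;> by_contra h₂
    · exact h (.inr (.inr (.inr ⟨h₂, h₁⟩)))
    · exact h (.inr (.inr (.inl ⟨h₁, h₂⟩)))
  | @imp k φ ψ ih ih' =>
    rw [realize_imp, ih, ih', godel_imp]
    have h := fun h => hW (.inr (.inl (.inr ⟨k, _, _, e, ⟨φ, rfl⟩, ⟨ψ, rfl⟩, h⟩)))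
    constructor
    · intro h₁
      by_contra h₂
      by_cases h₃ : W (holdsAtom k (godel φ) e)
      · exact h (.inr (.inl ⟨h₂, h₁ h₃⟩))
      · exact h (.inr (.inr ⟨h₂, h₃⟩))
    · intro h₁ h₂
      by_contra h₃
      exact h (.inl ⟨h₁, h₂, h₃⟩)
  | @all k φ ih =>
    rw [realize_all, godel_all]
    constructor
    · intro h₁
      by_contra h₂
      obtain ⟨e', he, hd⟩ :=
        exists_extension k e (witnessName (holdsAtom k (allCode (godel φ)) e))
      refine hW (.inr (.inr (.inl ⟨k, _, e, e', ⟨φ, rfl⟩, he, .inr ⟨hd, h₂, ?_⟩⟩)))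
      rw [← ih, he.env_eq_snoc]
      exact h₁ _
    · intro h₁ x
      obtain ⟨e', he, hd⟩ := exists_extension k e x.name
      have h₂ : W (holdsAtom (k + 1) (godel φ) e') := by
        by_contra h₂
        exact hW (.inr (.inr (.inl ⟨k, _, e, e', ⟨φ, rfl⟩, he, .inl ⟨h₁, h₂⟩⟩)))
      rw [← ih, he.env_eq_snoc, hd, mk_name] at h₂
      exact h₂

theorem TermModel.realize_sentence (φ : LA.Sentence) (e : ℕ) :
    TermModel hW ⊨ φ ↔ W (holdsAtom 0 (godel φ) e) := by
  rw [← realize_formula hW φ e, Sentence.Realize, Formula.Realize]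
  exact iff_of_eq (congrArg _ (Subsingleton.elim _ _))

end TermModel

/-- `x` codes a formula whose denial is refutable. -/
def DerivableCode (T : LA.Theory) (x : ℕ) : Prop :=
  Refutable T (consCode (2 * holdsAtom 0 x 0) 0)

theorem satisfies_denial_iff {W : ℕ → Prop} {a : ℕ} :
    Satisfies W (consCode (2 * a) 0) ↔ ¬ W a := by
  have h : ∀ s, MemCode s (consCode (2 * a) 0) ↔ s = 2 * a := fun s => by
    rw [memCode_consCode, ← Encodable.encode_list_nil (α := ℕ), memCode_encode]
    simp
  refine ⟨fun h' => h'.2 a ((h _).2 rfl), fun ha => ⟨fun b hb => ?_, fun b hb => ?_⟩⟩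
  · have := (h _).1 hb
    omega
  · have := (h _).1 hb
    rwa [show b = a by omega]

theorem Proves.derivableCode {T : LA.Theory} {φ : LA.Sentence} (h : Proves T φ) :
    DerivableCode T (godel φ) := by
  by_contra hx
  obtain ⟨W, hW, hs⟩ := exists_satisfies hx
  rw [satisfies_denial_iff] at hs
  have hM : TermModel hW ⊨ T := ⟨fun ψ hψ => by
    rw [TermModel.realize_sentence hW ψ 0]
    by_contra hn
    exact hW (.inl (.inr ⟨_, 0, ⟨ψ, hψ, rfl⟩, hn⟩))⟩
  exact hs ((TermModel.realize_sentence hW φ 0).1 (Theory.ModelsBoundedFormula.realize_sentence h _))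

section StandardValuation

/-- One step of the recursion defining `evalName`. -/
noncomputable def evalNameStep (x : ℕ) (f : ℕ → ℕ) : ℕ :=
  match x.unpair.1 with
  | 0 => 0
  | 1 => f x.unpair.2 + 1
  | 2 => f x.unpair.2.unpair.1 + f x.unpair.2.unpair.2
  | 3 => f x.unpair.2.unpair.1 * f x.unpair.2.unpair.2
  | _ => Classical.epsilon fun m => ∃ (k : ℕ) (φ : LA.BoundedFormula Empty (k + 1)) (e : ℕ),
      x.unpair.2 = holdsAtom k (godel φ.all) e ∧
        ¬ φ.Realize default (Fin.snoc (fun i : Fin k => f (Nat.beta e i)) m : Fin (k + 1) → ℕ)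

/-- The standard interpretation of names. -/
noncomputable def evalName (x : ℕ) : ℕ :=
  evalNameStep x fun y => if _h : y < x then evalName y else 0

theorem lt_pair_of_pos {a b : ℕ} (ha : 0 < a) : b < Nat.pair a b := by
  have := Nat.add_le_pair a b
  omega

theorem evalName_zero : evalName (Nat.pair 0 0) = 0 := by
  rw [evalName]
  simp [evalNameStep]

theorem evalName_succ (a : ℕ) : evalName (Nat.pair 1 a) = evalName a + 1 := by
  rw [evalName]
  simp [evalNameStep, lt_pair_of_pos]

theorem evalName_add (a b : ℕ) :
    evalName (Nat.pair 2 (Nat.pair a b)) = evalName a + evalName b := by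
  have h : Nat.pair a b < Nat.pair 2 (Nat.pair a b) := lt_pair_of_pos two_pos
  rw [evalName]
  simp [evalNameStep, (Nat.left_le_pair a b).trans_lt h, (Nat.right_le_pair a b).trans_lt h]

theorem evalName_mul (a b : ℕ) :
    evalName (Nat.pair 3 (Nat.pair a b)) = evalName a * evalName b := by
  have h : Nat.pair a b < Nat.pair 3 (Nat.pair a b) := lt_pair_of_pos three_pos
  rw [evalName]
  simp [evalNameStep, (Nat.left_le_pair a b).trans_lt h, (Nat.right_le_pair a b).trans_lt h]

theorem holdsAtom_inj {k a e k' a' e' : ℕ} :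
    holdsAtom k a e = holdsAtom k' a' e' ↔ k = k' ∧ a = a' ∧ e = e' := by
  simp [holdsAtom, and_assoc]

theorem beta_le (e i : ℕ) : Nat.beta e i ≤ e :=
  (Nat.mod_le _ _).trans (Nat.unpair_left_le e)

theorem evalName_witness {k : ℕ} (φ : LA.BoundedFormula Empty (k + 1)) (e : ℕ)
    (h : φ.Realize default (Fin.snoc (fun i : Fin k => evalName (Nat.beta e i))
      (evalName (witnessName (holdsAtom k (godel φ.all) e))) : Fin (k + 1) → ℕ)) :
    φ.all.Realize default fun i : Fin k => evalName (Nat.beta e i) := by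
  rw [realize_all]
  by_contra! hm
  have hlt : ∀ i, Nat.beta e i < Nat.pair 4 (holdsAtom k (godel φ.all) e) := fun i =>
    ((beta_le e i).trans ((Nat.right_le_pair _ _).trans (Nat.right_le_pair _ _))).trans_lt
      (lt_pair_of_pos four_pos)
  have hspec := Classical.epsilon_spec
    (p := fun m => ¬ φ.Realize default (Fin.snoc (fun i : Fin k => evalName (Nat.beta e i)) m :
      Fin (k + 1) → ℕ)) hm
  refine hspec ?_
  convert h using 2
  conv_rhs => rw [evalName]
  simp only [evalNameStep, witnessName, Nat.unpair_pair]
  congr 1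
  funext m
  apply propext
  constructor
  · intro hm
    refine ⟨k, φ, e, rfl, ?_⟩
    simpa [hlt] using hm
  · rintro ⟨k', φ', e', heq, hm⟩
    obtain ⟨rfl, hφ, rfl⟩ := holdsAtom_inj.1 heq
    obtain rfl : φ = φ' := by simpa using godel_injective hφ
    simpa [hlt] using hm

/-- The valuation of assertions given by the standard interpretation of names. -/
def StandardHolds (x : ℕ) : Prop :=
  (∃ (k : ℕ) (φ : LA.BoundedFormula Empty k) (e : ℕ), x = holdsAtom k (godel φ) e ∧
    φ.Realize default fun i : Fin k => evalName (Nat.beta e i)) ∨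
  (∃ a b, x = eqAtom a b ∧ evalName a = evalName b) ∨
  ∃ a b, x = leAtom a b ∧ evalName a ≤ evalName b

theorem standardHolds_holdsAtom {k : ℕ} {φ : LA.BoundedFormula Empty k} {e : ℕ} :
    StandardHolds (holdsAtom k (godel φ) e) ↔
      φ.Realize default fun i : Fin k => evalName (Nat.beta e i) := by
  refine ⟨?_, fun h => .inl ⟨k, φ, e, rfl, h⟩⟩
  rintro (⟨k', φ', e', heq, h⟩ | ⟨a, b, heq, -⟩ | ⟨a, b, heq, -⟩)
  · obtain ⟨rfl, hφ, rfl⟩ := holdsAtom_inj.1 heq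
    rwa [godel_injective hφ]
  · simp [holdsAtom, eqAtom] at heq
  · simp [holdsAtom, leAtom] at heq

theorem standardHolds_eqAtom {a b : ℕ} :
    StandardHolds (eqAtom a b) ↔ evalName a = evalName b := by
  simp [StandardHolds, holdsAtom, eqAtom, leAtom]

theorem standardHolds_leAtom {a b : ℕ} :
    StandardHolds (leAtom a b) ↔ evalName a ≤ evalName b := by
  simp [StandardHolds, holdsAtom, eqAtom, leAtom]

theorem evalName_termName {k : ℕ} (e : ℕ) (t : LA.Term (Empty ⊕ Fin k)) :
    evalName (termName e t) =
      t.realize (Sum.elim default fun i : Fin k => evalName (Nat.beta e i)) := by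
  induction t using term_cases with
  | var i =>
    rcases i with i | i
    · exact i.elim
    · rfl
  | zero => exact evalName_zero
  | succ t ih =>
    rw [termName_succT, evalName_succ, ih]
    rfl
  | add t s ih ih' =>
    rw [termName_addT, evalName_add, ih, ih']
    rfl
  | mul t s ih ih' =>
    rw [termName_mulT, evalName_mul, ih, ih']
    rfl

theorem not_clash_standardHolds {T : LA.Theory} (hT : ∀ φ ∈ T, ℕ ⊨ φ) :
    ¬ Clash T StandardHolds fun a => ¬ StandardHolds a := by
  rintro (h | h | h | h | h)
  · rcases h with ⟨a, h, h'⟩ | ⟨_, e, ⟨φ, hφ, rfl⟩, h⟩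
    · exact h' h
    · rw [standardHolds_holdsAtom] at h
      refine h ?_
      have := hT φ hφ
      rw [Sentence.Realize, Formula.Realize] at this
      convert this
  · rcases h with ⟨k, e, h⟩ | ⟨k, _, _, e, ⟨φ, rfl⟩, ⟨ψ, rfl⟩, h⟩
    · rw [← godel_falsum, standardHolds_holdsAtom] at h
      exact h
    · simp only [← godel_imp, standardHolds_holdsAtom, realize_imp] at h
      tauto
  · obtain ⟨k, _, e, e', ⟨φ, rfl⟩, he, h⟩ := h
    simp only [← godel_all, standardHolds_holdsAtom, he.env_eq_snoc] at h
    rcases h with ⟨h, h'⟩ | ⟨hw, h, h'⟩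
    · exact h' (realize_all.1 h _)
    · rw [hw] at h'
      exact h (evalName_witness φ e h')
  · obtain ⟨k, e, _, _, _, _, ⟨t, rfl, rfl⟩, ⟨s, rfl, rfl⟩, h⟩ := h
    simp only [← godel_equal, ← godel_leF, standardHolds_holdsAtom, standardHolds_eqAtom,
      standardHolds_leAtom, realize_bdEqual, realize_leF, evalName_termName] at h
    tauto
  · simp only [EqualityClash, standardHolds_eqAtom, standardHolds_leAtom, evalName_succ,
      evalName_add, evalName_mul] at h
    rcases h with ⟨a, h⟩ | ⟨a, b, c, h₁, h₂, h₃⟩ | ⟨a, b, h₁, h₂⟩ | ⟨a, b, c, d, h₁, h₂, h⟩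
    · exact h trivial
    · exact h₃ (h₁.symm.trans h₂)
    · exact h₂ (by rw [h₁])
    · simp only [h₁, h₂] at h
      tauto

end StandardValuation

theorem DerivableCode.realize {T : LA.Theory} (hT : ∀ φ ∈ T, ℕ ⊨ φ) {φ : LA.Sentence}
    (h : DerivableCode T (godel φ)) : ℕ ⊨ φ := by
  have h' := Refutable.not_satisfies (not_clash_standardHolds hT) h
  rw [satisfies_denial_iff, not_not, standardHolds_holdsAtom] at h'
  rw [Sentence.Realize, Formula.Realize]
  convert h'

section Diagonalization

/-- The numeral of `m` as a term in context `k`. -/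
def numeralIn (k : ℕ) : ℕ → LA.Term (Empty ⊕ Fin k)
  | 0 => zeroT
  | m + 1 => succT (numeralIn k m)

theorem realize_numeralIn {k : ℕ} (v : Empty ⊕ Fin k → ℕ) :
    ∀ m, (numeralIn k m).realize v = m
  | 0 => rfl
  | m + 1 => congrArg (· + 1) (realize_numeralIn v m)

/-- The graph of the map sending a number to the code of its numeral. -/
theorem derivable_numeral_iff {k x : ℕ} :
    Derivable (fun x => x = Nat.pair 0 (consCode 1 0))
      (fun y _ x => ∃ m c, y = Nat.pair m c ∧ x = Nat.pair (m + 1) (consCode 3 c)) x ↔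
    ∃ m, x = Nat.pair m (termCode (numeralIn k m)) := by
  constructor
  · intro h
    induction h with
    | base h => exact ⟨0, h⟩
    | step _ _ s ih _ =>
      obtain ⟨m, c, rfl, rfl⟩ := s
      obtain ⟨m', h⟩ := ih
      obtain ⟨rfl, rfl⟩ := Nat.pair_eq_pair.1 h
      exact ⟨m + 1, by rw [numeralIn, termCode_succT]⟩
  · rintro ⟨m, rfl⟩
    induction m with
    | zero => exact .base rfl
    | succ m ih => exact .step ih ih ⟨m, _, rfl, by rw [numeralIn, termCode_succT]⟩

/-- The code of the sentence `∀ x, x ≠ m̄ ∨ θ(x)`, where `a` is the code of `θ`. -/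
def instanceCode (m a : ℕ) : ℕ :=
  allCode (impCode (impCode (impCode (equalCode 1 (consCode 2 0) (termCode (numeralIn 1 m)))
    (falsumCode 1)) (falsumCode 1)) a)

theorem godel_instance (θ : LA.BoundedFormula Empty 1) (m : ℕ) :
    godel (∼((&0 : LA.Term (Empty ⊕ Fin 1)) =' numeralIn 1 m) ⊔ θ).all =
      instanceCode m (godel θ) := by
  have h : (∼((&0 : LA.Term (Empty ⊕ Fin 1)) =' numeralIn 1 m) ⊔ θ) =
      ((((&0 : LA.Term (Empty ⊕ Fin 1)) =' numeralIn 1 m) ⟹ ⊥) ⟹ ⊥) ⟹ θ := rfl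
  rw [godel_all, h, godel_imp, godel_imp, godel_imp, godel_equal, godel_falsum, termCode_var]
  rfl

theorem realize_instance (θ : LA.BoundedFormula Empty 1) (m : ℕ) :
    ℕ ⊨ ((∼((&0 : LA.Term (Empty ⊕ Fin 1)) =' numeralIn 1 m) ⊔ θ).all : LA.Sentence) ↔
      θ.Realize default ![m] := by
  have h : ∀ (v : Fin 0 → ℕ) (a : ℕ), (Fin.snoc v a : Fin (0 + 1) → ℕ) = ![a] := fun v a => by
    funext i
    fin_cases i
    rfl
  rw [Sentence.Realize, Formula.Realize, realize_all]
  have key : ∀ a : ℕ, (∼((&0 : LA.Term (Empty ⊕ Fin 1)) =' numeralIn 1 m) ⊔ θ).Realize default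
      ![a] ↔ (a = m → θ.Realize default ![a]) := fun a => by
    rw [realize_sup, realize_not, realize_bdEqual, realize_numeralIn, imp_iff_not_or]
    rfl
  refine (forall_congr' fun a => ?_).trans (forall_eq (p := fun a => θ.Realize default ![a]))
  rw [← key, ← h default]
  exact iff_of_eq (congrArg₂ _ (Subsingleton.elim _ _) rfl)

variable {n k : ℕ} {T : LA.Theory} {f g : (Fin k → ℕ) → ℕ}

theorem SigmaFun.instanceCode (hf : SigmaFun n f) (hg : SigmaFun n g) :
    SigmaFun n fun v => instanceCode (f v) (g v) := by
  have h : SigmaFun n fun v => termCode (numeralIn 1 (f v)) := by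
    refine ⟨SigmaRel.congr (SigmaRel.derivable (B := fun x => x = Nat.pair 0 (GRNonRE.consCode 1 0))
      (S := fun y _ x => ∃ m c, y = Nat.pair m c ∧
        x = Nat.pair (m + 1) (GRNonRE.consCode 3 c))
      (.eq (.var 0) (.const _))
      (.ex (.ex (.and (.eq (.var 0) (.pair (.var 3) (.var 4)))
        (.eq (.var 2) (.pair (.succ (.var 3)) (.consCode (.const 3) (.var 4)))))))
      (.pair hf.weaken (.var (Fin.last k)))) fun v => ?_⟩
    rw [derivable_numeral_iff (k := 1)]
    simp only [Nat.pair_eq_pair]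
    constructor
    · exact fun e => ⟨_, rfl, e⟩
    · rintro ⟨_, rfl, e⟩
      exact e
  exact .allCode (.impCode (.impCode (.impCode (.equalCode (.const 1) (.const _) h) (.const _))
    (.const _)) hg)

theorem SigmaRel.derivableCode (hT : PiDefinable n (GRNonRE.axiomCodes T)) (hf : SigmaFun n f) :
    SigmaRel n fun v => DerivableCode T (f v) :=
  .refutable hT (.consCode (.mul (.const 2) (.holdsAtom (.const 0) hf (.const 0))) (.const 0))

/-- A `Π_{n+1}`-sentence asserting its own underivability from `T`. -/
theorem exists_godel_sentence (hT : PiDefinable n (axiomCodes T)) :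
    ∃ φ : LA.Sentence, IsPi (n + 1) φ ∧ (ℕ ⊨ φ ↔ ¬ DerivableCode T (godel φ)) := by
  obtain ⟨χ, hχ, r⟩ : SigmaRel n fun v : Fin 1 → ℕ =>
      DerivableCode T (instanceCode (v 0) (v 0)) :=
    .derivableCode hT (.instanceCode (.var 0) (.var 0))
  obtain ⟨θ, hθ, hneg⟩ := hχ.exists_negation
  refine ⟨(∼((&0 : LA.Term (Empty ⊕ Fin 1)) =' numeralIn 1 (godel θ)) ⊔ θ).all,
    .all (.sup (Delta0.isPi (.imp (.equal _ _) .falsum) _) hθ), ?_⟩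
  rw [realize_instance, godel_instance, hneg, r]
  rfl

end Diagonalization

/-- **Corollary 2.2.** No sound and `Πₙ`-definable extension of `Q` is
`Π_{n+1}`-complete. -/
theorem sound_piDefinable_not_piSuccComplete (n : ℕ) (T : LA.Theory)
    (hQ : ExtendsQ T) (hdef : PiDefinable n (axiomCodes T)) (hsound : Sound T) :
    ∃ φ : LA.Sentence, IsPi (n + 1) φ ∧ ℕ ⊨ φ ∧ ¬ Proves T φ := by
  obtain ⟨φ, hφ, h⟩ := exists_godel_sentence hdef
  have hn : ¬ DerivableCode T (godel φ) := fun hd =>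
    h.1 (hd.realize fun ψ hψ => hsound ψ (Theory.models_sentence_of_mem hψ)) hd
  exact ⟨φ, hφ, h.2 hn, fun hp => hn hp.derivableCode⟩

end GRNonRE
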